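/- arXiv:1108.4067 — 15 statements merged into one kernel-verified Lean document; each statement's English description precedes it below -/
import Mathlib

section
/- Let X and Y be real normed vector spaces, T : X → Y a bounded linear operator, y ∈ Y, α > 0, D ⊆ X, and W : D → ℝ a functional satisfying hypotheses (H1), (H2) and (H3). Then the generalized Tikhonov–Phillips functional J_{W,α}(x) = ‖Tx − y‖² + α·W(x) attains a global minimum on D, i.e. there exists x̄ ∈ D such that J_{W,α}(x̄) ≤ J_{W,α}(x) for all x ∈ D. -/
open Filter Topology

/-- Existence of a global minimizer for the generalized Tikhonov-Phillips functional
`J_{W,α}(x) = ‖Tx - y‖² + α W x` on `D`, under hypotheses (H1), (H2), (H3). -/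
theorem existence_generalized_tikhonov
    {X Y : Type*} [NormedAddCommGroup X] [NormedSpace ℝ X]
    [NormedAddCommGroup Y] [NormedSpace ℝ Y]
    (T : X →L[ℝ] Y) (y : Y) (α : ℝ) (hα : 0 < α)
    (D : Set X) (hD : D.Nonempty) (W : X → ℝ)
    -- (H1)
    (H1 : ∃ γ : ℝ, 0 ≤ γ ∧ ∀ x ∈ D, -γ ≤ W x)
    -- (H2)
    (H2 : ∀ x : ℕ → X, (∀ n, x n ∈ D) → (∃ k : ℝ, ∀ n, |W (x n)| ≤ k) →
      ∀ x₀ ∈ D, (∀ f : X →L[ℝ] ℝ, Tendsto (fun n => f (x n)) atTop (𝓝 (f x₀))) →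
      ∃ φ : ℕ → ℕ, StrictMono φ ∧ W x₀ ≤ liminf (fun j => W (x (φ j))) atTop)
    -- (H3)
    (H3 : ∀ x : ℕ → X, (∀ n, x n ∈ D) → (∃ k : ℝ, ∀ n, |W (x n)| ≤ k) →
      ∃ φ : ℕ → ℕ, StrictMono φ ∧ ∃ x₀ ∈ D,
        ∀ f : X →L[ℝ] ℝ, Tendsto (fun n => f (x (φ n))) atTop (𝓝 (f x₀))) :
    ∃ xbar ∈ D, ∀ x ∈ D,
      ‖T xbar - y‖ ^ 2 + α * W xbar ≤ ‖T x - y‖ ^ 2 + α * W x := by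
  obtain ⟨γ, -, hγ⟩ := H1
  set J : X → ℝ := fun x => ‖T x - y‖ ^ 2 + α * W x with hJ
  have hbdd : BddBelow (J '' D) := by
    refine ⟨α * -γ, ?_⟩
    rintro _ ⟨x, hx, rfl⟩
    have h := mul_le_mul_of_nonneg_left (hγ x hx) hα.le
    have h' := sq_nonneg ‖T x - y‖
    simp only [hJ]
    linarith
  set m := sInf (J '' D) with hm
  have hmin : ∀ n : ℕ, ∃ x ∈ D, J x < m + 1 / ((n : ℝ) + 1) := by
    intro n
    obtain ⟨_, ⟨x, hx, rfl⟩, hlt⟩ := exists_lt_of_csInf_lt (hD.image J)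
      (lt_add_of_pos_right m (Nat.one_div_pos_of_nat (α := ℝ) (n := n)))
    exact ⟨x, hx, hlt⟩
  choose x hxD hx using hmin
  have hWle : ∀ n, W (x n) ≤ (m + 1) / α := by
    intro n
    have h1 : 1 / ((n : ℝ) + 1) ≤ 1 := by
      rw [div_le_one (by positivity)]
      linarith [(Nat.cast_nonneg n : (0 : ℝ) ≤ n)]
    have h2 : ‖T (x n) - y‖ ^ 2 + α * W (x n) < m + 1 / ((n : ℝ) + 1) := hx n
    rw [le_div_iff₀ hα]
    linarith [sq_nonneg ‖T (x n) - y‖, mul_comm α (W (x n))]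
  have hWbdd : ∀ n, |W (x n)| ≤ max γ ((m + 1) / α) := fun n =>
    abs_le.2 ⟨by linarith [hγ _ (hxD n), le_max_left γ ((m + 1) / α)],
      (hWle n).trans (le_max_right _ _)⟩
  obtain ⟨φ, hφ, x₀, hx₀, hweak⟩ := H3 x hxD ⟨_, hWbdd⟩
  obtain ⟨ψ, hψ, hlim⟩ := H2 (fun n => x (φ n)) (fun n => hxD _) ⟨_, fun n => hWbdd _⟩
    x₀ hx₀ hweak
  refine ⟨x₀, hx₀, fun z hz => le_trans ?_ (csInf_le hbdd ⟨z, hz, rfl⟩)⟩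
  have hθ : Tendsto (fun j => φ (ψ j)) atTop atTop := hφ.tendsto_atTop.comp hψ.tendsto_atTop
  obtain ⟨g, hg, hgy⟩ := exists_dual_vector'' ℝ (T x₀ - y)
  have hgy' : g (T x₀) - g y = ‖T x₀ - y‖ := by simpa using hgy
  have hgT : Tendsto (fun j => g (T (x (φ (ψ j))))) atTop (𝓝 (g (T x₀))) :=
    (hweak (g.comp T)).comp hψ.tendsto_atTop
  -- The convex function `t ↦ t ^ 2` lies above its tangent at `‖T x₀ - y‖`.
  have hlower : ∀ u, 2 * ‖T x₀ - y‖ * (g (T u) - g y) - ‖T x₀ - y‖ ^ 2 ≤ ‖T u - y‖ ^ 2 := by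
    intro u
    have h1 : g (T u) - g y ≤ ‖T u - y‖ := by
      rw [← map_sub]
      exact (le_abs_self _).trans (by simpa using g.le_of_opNorm_le hg (T u - y))
    nlinarith [mul_le_mul_of_nonneg_left h1 (norm_nonneg (T x₀ - y)),
      sq_nonneg (‖T u - y‖ - ‖T x₀ - y‖)]
  have htan : Tendsto (fun j => m + 1 / (((φ (ψ j) : ℕ) : ℝ) + 1)
      - (2 * ‖T x₀ - y‖ * (g (T (x (φ (ψ j)))) - g y) - ‖T x₀ - y‖ ^ 2)) atTop
      (𝓝 (m + 0 - (2 * ‖T x₀ - y‖ * (g (T x₀) - g y) - ‖T x₀ - y‖ ^ 2))) :=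
    ((tendsto_one_div_add_atTop_nhds_zero_nat.comp hθ).const_add m).sub
      (((hgT.sub_const _).const_mul _).sub_const _)
  rw [hgy'] at htan
  have hbelow : IsBoundedUnder (· ≥ ·) atTop (fun j => W (x (φ (ψ j)))) :=
    isBoundedUnder_of ⟨-γ, fun j => hγ _ (hxD _)⟩
  have key : ∀ c < W x₀, ‖T x₀ - y‖ ^ 2 + α * c ≤ m := by
    intro c hc
    have hev := eventually_lt_of_lt_liminf (hc.trans_le hlim) hbelow
    have := ge_of_tendsto htan (b := α * c) (hev.mono fun j hj => by
      have h1 : ‖T (x (φ (ψ j))) - y‖ ^ 2 + α * W (x (φ (ψ j)))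
        < m + 1 / (((φ (ψ j) : ℕ) : ℝ) + 1) := hx _
      linarith [hlower (x (φ (ψ j))), mul_lt_mul_of_pos_left hj hα])
    nlinarith
  have hW : W x₀ ≤ (m - ‖T x₀ - y‖ ^ 2) / α :=
    le_of_forall_lt_imp_le_of_dense fun c hc => by
      rw [le_div_iff₀ hα]
      linarith [key c hc]
  rw [le_div_iff₀ hα] at hW
  linarith
end

section
/- Let X be a real normed vector space, Y a real inner product space, T : X → Y a bounded linear operator, y ∈ Y, α > 0, D ⊆ X a convex set, and W : D → ℝ a functional satisfying hypotheses (H1), (H2) and (H3). If either W is convex and T is injective, or W is strictly convex, then the functional J_{W,α}(x) = ‖Tx − y‖² + α·W(x) has a unique global minimizer on D. -/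
open Filter Topology

/-- The squared norm lies above its tangent functional at every point. -/
theorem norm_sq_add_two_inner_sub_le {Y : Type*} [NormedAddCommGroup Y] [InnerProductSpace ℝ Y]
    (v w : Y) : ‖v‖ ^ 2 + 2 * inner ℝ v (w - v) ≤ ‖w‖ ^ 2 := by
  have h := norm_add_sq_real v (w - v)
  rw [add_sub_cancel] at h
  nlinarith [sq_nonneg ‖w - v‖]

/-- Parallelogram identity for the residual at a midpoint. -/
theorem norm_midpoint_residual_sq {X Y : Type*} [AddCommGroup X] [Module ℝ X]
    [NormedAddCommGroup Y] [InnerProductSpace ℝ Y] (T : X →ₗ[ℝ] Y) (y : Y) (x x' : X) :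
    ‖T ((1 / 2 : ℝ) • x + (1 - 1 / 2 : ℝ) • x') - y‖ ^ 2 =
      (‖T x - y‖ ^ 2 + ‖T x' - y‖ ^ 2) / 2 - ‖T x - T x'‖ ^ 2 / 4 := by
  have hmid : T ((1 / 2 : ℝ) • x + (1 - 1 / 2 : ℝ) • x') - y =
      (1 / 2 : ℝ) • ((T x - y) + (T x' - y)) := by
    rw [map_add, map_smul, map_smul]
    module
  have hdiff : T x - T x' = (T x - y) - (T x' - y) := by abel
  rw [hmid, hdiff, norm_smul, mul_pow, norm_add_sq_real,
    norm_sub_sq_real (T x - y) (T x' - y)]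
  norm_num
  ring

/-- If `u` converges weakly to `x₀`, the values `‖T (u n) - y‖ ^ 2 + α * W (u n)` converge to `m`,
and `W x₀` is at most the lower limit of `W (u n)`, then the value at `x₀` is at most `m`. -/
theorem tikhonov_le_of_weak_limit {X Y : Type*} [NormedAddCommGroup X] [NormedSpace ℝ X]
    [NormedAddCommGroup Y] [InnerProductSpace ℝ Y] (T : X →L[ℝ] Y) (y : Y) {α : ℝ} (hα : 0 < α)
    {W : X → ℝ} {u : ℕ → X} {x₀ : X} {c m : ℝ} (hbelow : ∀ n, c ≤ W (u n))
    (hweak : ∀ f : X →L[ℝ] ℝ, Tendsto (fun n => f (u n)) atTop (𝓝 (f x₀)))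
    (hW : W x₀ ≤ liminf (fun n => W (u n)) atTop)
    (hJ : Tendsto (fun n => ‖T (u n) - y‖ ^ 2 + α * W (u n)) atTop (𝓝 m)) :
    ‖T x₀ - y‖ ^ 2 + α * W x₀ ≤ m := by
  set v := T x₀ - y with hv
  set g : X →L[ℝ] ℝ := (innerSL ℝ v).comp T
  have hlim : Tendsto (fun n => (‖T (u n) - y‖ ^ 2 + α * W (u n) - ‖v‖ ^ 2 -
      2 * (g (u n) - g x₀)) / α) atTop (𝓝 ((m - ‖v‖ ^ 2) / α)) := by
    have h := (((hJ.sub_const (‖v‖ ^ 2)).sub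
      (((hweak g).sub_const (g x₀)).const_mul 2)).div_const α)
    simpa using h
  have hle : ∀ n, W (u n) ≤ (‖T (u n) - y‖ ^ 2 + α * W (u n) - ‖v‖ ^ 2 -
      2 * (g (u n) - g x₀)) / α := by
    intro n
    have htangent := norm_sq_add_two_inner_sub_le v (T (u n) - y)
    have hinner : inner ℝ v (T (u n) - y - v) = g (u n) - g x₀ := by
      rw [hv, sub_sub_sub_cancel_right, inner_sub_right]
      rfl
    rw [hinner] at htangent
    rw [le_div_iff₀ hα]
    linarith
  have hliminf : liminf (fun n => W (u n)) atTop ≤ (m - ‖v‖ ^ 2) / α := by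
    rw [← hlim.liminf_eq]
    exact liminf_le_liminf (Eventually.of_forall hle)
      (isBoundedUnder_of ⟨c, hbelow⟩) hlim.isBoundedUnder_le.isCoboundedUnder_ge
  have h := hW.trans hliminf
  rw [le_div_iff₀ hα] at h
  linarith

/-- Existence and uniqueness of a global minimizer of
`J_{W,α}(x) = ‖Tx - y‖² + α W x` on a convex set `D`, under (H1), (H2), (H3),
provided either `W` is convex and `T` injective, or `W` is strictly convex. -/
theorem existence_uniqueness_generalized_tikhonov
    {X Y : Type*} [NormedAddCommGroup X] [NormedSpace ℝ X]
    [NormedAddCommGroup Y] [InnerProductSpace ℝ Y]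
    (T : X →L[ℝ] Y) (y : Y) (α : ℝ) (hα : 0 < α)
    (D : Set X) (hD : D.Nonempty) (hDconv : Convex ℝ D) (W : X → ℝ)
    -- (H1)
    (H1 : ∃ γ : ℝ, 0 ≤ γ ∧ ∀ x ∈ D, -γ ≤ W x)
    -- (H2)
    (H2 : ∀ x : ℕ → X, (∀ n, x n ∈ D) → (∃ k : ℝ, ∀ n, |W (x n)| ≤ k) →
      ∀ x₀ ∈ D, (∀ f : X →L[ℝ] ℝ, Tendsto (fun n => f (x n)) atTop (𝓝 (f x₀))) →
      ∃ φ : ℕ → ℕ, StrictMono φ ∧ W x₀ ≤ liminf (fun j => W (x (φ j))) atTop)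
    -- (H3)
    (H3 : ∀ x : ℕ → X, (∀ n, x n ∈ D) → (∃ k : ℝ, ∀ n, |W (x n)| ≤ k) →
      ∃ φ : ℕ → ℕ, StrictMono φ ∧ ∃ x₀ ∈ D,
        ∀ f : X →L[ℝ] ℝ, Tendsto (fun n => f (x (φ n))) atTop (𝓝 (f x₀)))
    -- W convex and T injective, or W strictly convex
    (hconvex :
      ((∀ x ∈ D, ∀ x' ∈ D, ∀ t : ℝ, 0 ≤ t → t ≤ 1 →
          W (t • x + (1 - t) • x') ≤ t * W x + (1 - t) * W x') ∧
        Function.Injective T) ∨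
      (∀ x ∈ D, ∀ x' ∈ D, x ≠ x' → ∀ t : ℝ, 0 < t → t < 1 →
          W (t • x + (1 - t) • x') < t * W x + (1 - t) * W x')) :
    ∃! xbar : X, xbar ∈ D ∧ ∀ x ∈ D,
      ‖T xbar - y‖ ^ 2 + α * W xbar ≤ ‖T x - y‖ ^ 2 + α * W x := by
  obtain ⟨γ, -, hγ⟩ := H1
  set J : X → ℝ := fun x => ‖T x - y‖ ^ 2 + α * W x with hJ
  have hbdd : BddBelow (J '' D) := by
    refine ⟨α * -γ, ?_⟩
    rintro _ ⟨x, hx, rfl⟩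
    have h := mul_le_mul_of_nonneg_left (hγ x hx) hα.le
    have h' := sq_nonneg ‖T x - y‖
    simp only [hJ]
    linarith
  apply existsUnique_of_exists_of_unique
  · obtain ⟨j, -, hjlim, hjmem⟩ := exists_seq_tendsto_sInf (hD.image J) hbdd
    choose x hxD hxj using hjmem
    obtain rfl : J ∘ x = j := funext hxj
    obtain ⟨B, hB⟩ := hjlim.bddAbove_range
    have hWbdd : ∃ k : ℝ, ∀ n, |W (x n)| ≤ k := by
      refine ⟨max γ (B / α), fun n => abs_le'.2 ⟨le_max_of_le_right ?_, le_max_of_le_left ?_⟩⟩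
      · have h : ‖T (x n) - y‖ ^ 2 + α * W (x n) ≤ B := hB ⟨n, rfl⟩
        rw [le_div_iff₀ hα]
        linarith [sq_nonneg ‖T (x n) - y‖]
      · linarith [hγ _ (hxD n)]
    obtain ⟨φ, hφ, x₀, hx₀, hweak⟩ := H3 x hxD hWbdd
    obtain ⟨ψ, hψ, hliminf⟩ := H2 (fun n => x (φ n)) (fun n => hxD _)
      (hWbdd.imp fun _ hk n => hk _) x₀ hx₀ hweak
    refine ⟨x₀, hx₀, fun z hz => ?_⟩
    exact (tikhonov_le_of_weak_limit T y hα (fun n => hγ _ (hxD (φ (ψ n))))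
      (fun f => (hweak f).comp hψ.tendsto_atTop) hliminf
      (hjlim.comp (hφ.comp hψ).tendsto_atTop)).trans (csInf_le hbdd ⟨z, hz, rfl⟩)
  · rintro a b ⟨ha, hamin⟩ ⟨hb, hbmin⟩
    by_contra hab
    have hmid := norm_midpoint_residual_sq (T : X →ₗ[ℝ] Y) y a b
    simp only [ContinuousLinearMap.coe_coe] at hmid
    have hzD : (1 / 2 : ℝ) • a + (1 - 1 / 2 : ℝ) • b ∈ D :=
      hDconv ha hb (by norm_num) (by norm_num) (by norm_num)
    have hza := hamin _ hzD
    have hzb := hbmin _ hzD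
    rcases hconvex with ⟨hconv, hinj⟩ | hstrict
    · have hpos : 0 < ‖T a - T b‖ ^ 2 := by
        have := norm_pos_iff.2 (sub_ne_zero.2 (hinj.ne hab))
        positivity
      have hW := mul_le_mul_of_nonneg_left
        (hconv a ha b hb (1 / 2) (by norm_num) (by norm_num)) hα.le
      linarith
    · have hW := mul_lt_mul_of_pos_left
        (hstrict a ha b hb hab (1 / 2) (by norm_num) (by norm_num)) hα
      linarith [sq_nonneg ‖T a - T b‖]
end

section
/- Let X and Y be real normed vector spaces, T : X → Y a bounded linear operator, y ∈ Y, α > 0, D ⊆ X, and W : D → ℝ a functional satisfying hypotheses (H1), (H2') and (H3'). Then the functional J_{W,α}(x) = ‖Tx − y‖² + α·W(x) attains a global minimum on D. If moreover D is convex, Y is a real inner product space, and either W is convex and T is injective, or W is strictly convex, then the global minimizer is unique. -/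
open Filter Topology

/-- Existence of a Tikhonov minimizer for a target in an arbitrary real normed space. -/
theorem exists_tikhonov_minimizer
    {X Y : Type*} [NormedAddCommGroup X] [NormedSpace ℝ X]
    [NormedAddCommGroup Y] [NormedSpace ℝ Y]
    (T : X →L[ℝ] Y) (y : Y) {α : ℝ} (hα : 0 < α)
    {D : Set X} (hD : D.Nonempty) {W : X → ℝ}
    (H1 : ∃ γ : ℝ, 0 ≤ γ ∧ ∀ x ∈ D, -γ ≤ W x)
    (H2' : ∀ x : ℕ → X, (∀ n, x n ∈ D) → (∃ k : ℝ, ∀ n, |W (x n)| ≤ k) →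
      ∀ x₀ ∈ D, Tendsto x atTop (𝓝 x₀) →
      ∃ φ : ℕ → ℕ, StrictMono φ ∧ W x₀ ≤ liminf (fun j => W (x (φ j))) atTop)
    (H3' : ∀ x : ℕ → X, (∀ n, x n ∈ D) → (∃ k : ℝ, ∀ n, |W (x n)| ≤ k) →
      ∃ φ : ℕ → ℕ, StrictMono φ ∧ ∃ x₀ ∈ D, Tendsto (x ∘ φ) atTop (𝓝 x₀)) :
    ∃ xbar ∈ D, ∀ x ∈ D,
      ‖T xbar - y‖ ^ 2 + α * W xbar ≤ ‖T x - y‖ ^ 2 + α * W x := by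
  obtain ⟨γ, -, hγ⟩ := H1
  set J : X → ℝ := fun x => ‖T x - y‖ ^ 2 + α * W x with hJ
  have hbdd : BddBelow (J '' D) := by
    refine ⟨α * -γ, ?_⟩
    rintro _ ⟨x, hx, rfl⟩
    have h := mul_le_mul_of_nonneg_left (hγ x hx) hα.le
    have h' := sq_nonneg ‖T x - y‖
    simp only [hJ]
    linarith
  obtain ⟨u, -, hu, huJ⟩ := exists_seq_tendsto_sInf (hD.image J) hbdd
  choose x hxD hxu using huJ
  obtain ⟨B, hB⟩ := hu.bddAbove_range
  have hW : ∃ k : ℝ, ∀ n, |W (x n)| ≤ k := by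
    refine ⟨max γ (B / α), fun n => abs_le.2 ⟨?_, ?_⟩⟩
    · have := le_max_left γ (B / α)
      linarith [hγ (x n) (hxD n)]
    · refine le_trans ?_ (le_max_right _ _)
      rw [le_div_iff₀ hα]
      have h : J (x n) ≤ B := hxu n ▸ hB ⟨n, rfl⟩
      simp only [hJ] at h
      nlinarith [sq_nonneg ‖T (x n) - y‖]
  obtain ⟨φ, hφ, x₀, hx₀, hlim⟩ := H3' x hxD hW
  obtain ⟨ψ, hψ, hle⟩ := H2' (x ∘ φ) (fun n => hxD _)
    (hW.imp fun k hk n => hk _) x₀ hx₀ hlim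
  have hdata : Tendsto (fun j => ‖T (x (φ (ψ j))) - y‖ ^ 2) atTop (𝓝 (‖T x₀ - y‖ ^ 2)) :=
    ((((T.continuous.tendsto x₀).comp (hlim.comp hψ.tendsto_atTop)).sub_const y).norm).pow 2
  have hvalue : Tendsto (fun j => J (x (φ (ψ j)))) atTop (𝓝 (sInf (J '' D))) := by
    simp only [hxu]
    exact hu.comp (hφ.comp hψ).tendsto_atTop
  have hpenalty : Tendsto (fun j => W ((x ∘ φ) (ψ j))) atTop
      (𝓝 ((sInf (J '' D) - ‖T x₀ - y‖ ^ 2) / α)) := by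
    refine ((hvalue.sub hdata).div_const α).congr fun j => ?_
    simp only [hJ, Function.comp_apply]
    field_simp
    ring
  rw [hpenalty.liminf_eq, le_div_iff₀ hα] at hle
  refine ⟨x₀, hx₀, fun z hz => ?_⟩
  have h : sInf (J '' D) ≤ J z := csInf_le hbdd ⟨z, hz, rfl⟩
  simp only [hJ] at h hle
  linarith

/-- The parallelogram law, as an expression for the squared norm of a midpoint. -/
theorem norm_midpoint_sq {Y : Type*} [NormedAddCommGroup Y] [InnerProductSpace ℝ Y] (a b : Y) :
    ‖(1 / 2 : ℝ) • a + (1 - 1 / 2 : ℝ) • b‖ ^ 2 =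
      (‖a‖ ^ 2 + ‖b‖ ^ 2) / 2 - ‖a - b‖ ^ 2 / 4 := by
  rw [norm_add_sq_real, norm_sub_sq_real, norm_smul, norm_smul, real_inner_smul_left,
    real_inner_smul_right]
  norm_num
  ring

/-- Existence (and conditional uniqueness) of a global minimizer of
`J_{W,α}(x) = ‖Tx - y‖² + α W x` on `D` under hypotheses (H1), (H2'), (H3')
(strong-convergence versions of (H2), (H3)). -/
theorem existence_uniqueness_generalized_tikhonov_strong_hyps
    {X Y : Type*} [NormedAddCommGroup X] [NormedSpace ℝ X]
    [NormedAddCommGroup Y] [InnerProductSpace ℝ Y]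
    (T : X →L[ℝ] Y) (y : Y) (α : ℝ) (hα : 0 < α)
    (D : Set X) (hD : D.Nonempty) (W : X → ℝ)
    -- (H1)
    (H1 : ∃ γ : ℝ, 0 ≤ γ ∧ ∀ x ∈ D, -γ ≤ W x)
    -- (H2')
    (H2' : ∀ x : ℕ → X, (∀ n, x n ∈ D) → (∃ k : ℝ, ∀ n, |W (x n)| ≤ k) →
      ∀ x₀ ∈ D, Tendsto x atTop (𝓝 x₀) →
      ∃ φ : ℕ → ℕ, StrictMono φ ∧ W x₀ ≤ liminf (fun j => W (x (φ j))) atTop)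
    -- (H3')
    (H3' : ∀ x : ℕ → X, (∀ n, x n ∈ D) → (∃ k : ℝ, ∀ n, |W (x n)| ≤ k) →
      ∃ φ : ℕ → ℕ, StrictMono φ ∧ ∃ x₀ ∈ D, Tendsto (x ∘ φ) atTop (𝓝 x₀)) :
    -- existence of a global minimizer on D
    (∃ xbar ∈ D, ∀ x ∈ D,
      ‖T xbar - y‖ ^ 2 + α * W xbar ≤ ‖T x - y‖ ^ 2 + α * W x) ∧
    -- uniqueness under the additional convexity hypotheses
    (Convex ℝ D →
      (((∀ x ∈ D, ∀ x' ∈ D, ∀ t : ℝ, 0 ≤ t → t ≤ 1 →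
            W (t • x + (1 - t) • x') ≤ t * W x + (1 - t) * W x') ∧
          Function.Injective T) ∨
        (∀ x ∈ D, ∀ x' ∈ D, x ≠ x' → ∀ t : ℝ, 0 < t → t < 1 →
            W (t • x + (1 - t) • x') < t * W x + (1 - t) * W x')) →
      ∃! xbar : X, xbar ∈ D ∧ ∀ x ∈ D,
        ‖T xbar - y‖ ^ 2 + α * W xbar ≤ ‖T x - y‖ ^ 2 + α * W x) := by
  have hex := exists_tikhonov_minimizer T y hα hD H1 H2' H3'
  refine ⟨hex, fun hconv hW => ?_⟩
  obtain ⟨a, ha, hamin⟩ := hex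
  refine ⟨a, ⟨ha, hamin⟩, ?_⟩
  rintro b ⟨hb, hbmin⟩
  by_contra hne
  have hmid : (1 / 2 : ℝ) • b + (1 - 1 / 2 : ℝ) • a ∈ D :=
    hconv hb ha (by norm_num) (by norm_num) (by norm_num)
  have hdata : ‖T ((1 / 2 : ℝ) • b + (1 - 1 / 2 : ℝ) • a) - y‖ ^ 2 =
      (‖T b - y‖ ^ 2 + ‖T a - y‖ ^ 2) / 2 - ‖T b - T a‖ ^ 2 / 4 := by
    rw [← sub_sub_sub_cancel_right (T b) (T a) y, ← norm_midpoint_sq, map_add, map_smul, map_smul]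
    congr 2
    module
  have hmin := hamin _ hmid
  have hab := hbmin a ha
  rw [hdata] at hmin
  rcases hW with ⟨hW, hT⟩ | hW
  · have hpos : 0 < ‖T b - T a‖ ^ 2 :=
      pow_pos (norm_pos_iff.2 (sub_ne_zero.2 fun h => hne (hT h))) 2
    have h := mul_le_mul_of_nonneg_left
      (hW b hb a ha (1 / 2) (by norm_num) (by norm_num)) hα.le
    linarith
  · have h := mul_lt_mul_of_pos_left
      (hW b hb a ha hne (1 / 2) (by norm_num) (by norm_num)) hα
    linarith [sq_nonneg ‖T b - T a‖]
end

section
/- Let X and Y be real normed vector spaces, T : X → Y a bounded linear operator, y ∈ Y, α > 0, D ⊆ X, and W : D → ℝ a functional satisfying hypotheses (H1), (I2) and (I3). Then the functional J_{W,α}(x) = ‖Tx − y‖² + α·W(x) attains a global minimum on D. If moreover D is convex, Y is a real inner product space, and either W is convex and T is injective, or W is strictly convex, then the global minimizer is unique. -/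
open Filter Topology

/-- Weak lower semicontinuity of `x ↦ ‖T x - y‖ ^ 2`, in the form of a convergent minorant. -/
lemma exists_tendsto_le_norm_sub_sq {X Y : Type*} [NormedAddCommGroup X] [NormedSpace ℝ X]
    [NormedAddCommGroup Y] [NormedSpace ℝ Y] (T : X →L[ℝ] Y) (y : Y) (u : ℕ → X) (x₀ : X)
    (hu : ∀ f : X →L[ℝ] ℝ, Tendsto (fun n => f (u n)) atTop (𝓝 (f x₀))) :
    ∃ b : ℕ → ℝ, Tendsto b atTop (𝓝 (‖T x₀ - y‖ ^ 2)) ∧ ∀ n, b n ≤ ‖T (u n) - y‖ ^ 2 := by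
  obtain ⟨g, hg1, hg⟩ := exists_dual_vector'' ℝ (T x₀ - y)
  refine ⟨fun n => max (g (T (u n) - y)) 0 ^ 2, ?_, fun n => ?_⟩
  · have h : Tendsto (fun n => g (T (u n)) - g y) atTop (𝓝 (g (T x₀) - g y)) :=
      (hu (g.comp T)).sub_const _
    have h' := (h.max (tendsto_const_nhds (x := (0 : ℝ)))).pow 2
    rw [← map_sub, hg] at h'
    simpa using h'
  · have h : g (T (u n) - y) ≤ ‖T (u n) - y‖ :=
      (le_abs_self _).trans (by simpa using g.le_of_opNorm_le hg1 (T (u n) - y))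
    exact pow_le_pow_left₀ (le_max_right _ _) (max_le h (norm_nonneg _)) 2

/-- Existence of a minimizer of `‖T x - y‖ ^ 2 + α * W x` on `D`, for an arbitrary normed
space `Y`. -/
lemma exists_minimizer_generalized_tikhonov
    {X Y : Type*} [NormedAddCommGroup X] [NormedSpace ℝ X]
    [NormedAddCommGroup Y] [NormedSpace ℝ Y]
    (T : X →L[ℝ] Y) (y : Y) (α : ℝ) (hα : 0 < α)
    (D : Set X) (hD : D.Nonempty) (W : X → ℝ)
    (H1 : ∃ γ : ℝ, 0 ≤ γ ∧ ∀ x ∈ D, -γ ≤ W x)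
    (I2 : ∀ x : ℕ → X, (∀ n, x n ∈ D) → (∃ k : ℝ, ∀ n, |‖T (x n)‖ + W (x n)| ≤ k) →
      ∀ x₀ ∈ D, (∀ f : X →L[ℝ] ℝ, Tendsto (fun n => f (x n)) atTop (𝓝 (f x₀))) →
      ∃ φ : ℕ → ℕ, StrictMono φ ∧ W x₀ ≤ liminf (fun j => W (x (φ j))) atTop)
    (I3 : ∀ x : ℕ → X, (∀ n, x n ∈ D) → (∃ k : ℝ, ∀ n, |‖T (x n)‖ + W (x n)| ≤ k) →
      ∃ φ : ℕ → ℕ, StrictMono φ ∧ ∃ x₀ ∈ D,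
        ∀ f : X →L[ℝ] ℝ, Tendsto (fun n => f (x (φ n))) atTop (𝓝 (f x₀))) :
    ∃ xbar ∈ D, ∀ x ∈ D,
      ‖T xbar - y‖ ^ 2 + α * W xbar ≤ ‖T x - y‖ ^ 2 + α * W x := by
  obtain ⟨γ, hγ0, hγ⟩ := H1
  set J : X → ℝ := fun x => ‖T x - y‖ ^ 2 + α * W x with hJ
  have hbdd : BddBelow (J '' D) := by
    refine ⟨α * -γ, ?_⟩
    rintro _ ⟨x, hx, rfl⟩
    have := mul_le_mul_of_nonneg_left (hγ x hx) hα.le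
    simp only [hJ]
    nlinarith [sq_nonneg ‖T x - y‖]
  obtain ⟨v, -, hvlim, hvmem⟩ := exists_seq_tendsto_sInf (hD.image J) hbdd
  choose u huD huv using hvmem
  have hJlim : Tendsto (fun n => J (u n)) atTop (𝓝 (sInf (J '' D))) := by
    simpa only [huv] using hvlim
  obtain ⟨C, hC⟩ := hJlim.bddAbove_range
  replace hC : ∀ n, J (u n) ≤ C := fun n => hC ⟨n, rfl⟩
  have hk : ∀ n, |‖T (u n)‖ + W (u n)| ≤ (C + α * γ + 1 + ‖y‖) + |C / α| + γ := by
    intro n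
    have h1 := hC n
    simp only [hJ] at h1
    have h2 := hγ _ (huD n)
    have h3 := mul_le_mul_of_nonneg_left h2 hα.le
    have h4 : W (u n) ≤ C / α := by
      rw [le_div_iff₀ hα]
      nlinarith [sq_nonneg ‖T (u n) - y‖]
    have h5 : ‖T (u n)‖ ≤ ‖T (u n) - y‖ + ‖y‖ := norm_le_norm_sub_add _ _
    have h6 : ‖T (u n) - y‖ ≤ C + α * γ + 1 := by
      nlinarith [sq_nonneg (‖T (u n) - y‖ - 1), norm_nonneg (T (u n) - y)]
    rw [abs_le]
    constructor <;> linarith [le_abs_self (C / α), abs_nonneg (C / α), norm_nonneg (T (u n)),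
      norm_nonneg y, norm_nonneg (T (u n) - y)]
  obtain ⟨φ, hφ, x₀, hx₀, hweak⟩ := I3 u huD ⟨_, hk⟩
  obtain ⟨ψ, hψ, hW⟩ := I2 (fun n => u (φ n)) (fun n => huD _) ⟨_, fun n => hk _⟩ x₀ hx₀ hweak
  obtain ⟨b, hb, hbu⟩ := exists_tendsto_le_norm_sub_sq T y (fun j => u (φ (ψ j))) x₀
    (fun f => (hweak f).comp hψ.tendsto_atTop)
  have hlim : Tendsto (fun j => (J (u (φ (ψ j))) - b j) / α) atTop
      (𝓝 ((sInf (J '' D) - ‖T x₀ - y‖ ^ 2) / α)) :=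
    ((hJlim.comp (hφ.comp hψ).tendsto_atTop).sub hb).div_const α
  have hle : ∀ j, W (u (φ (ψ j))) ≤ (J (u (φ (ψ j))) - b j) / α := by
    intro j
    rw [le_div_iff₀ hα]
    have := hbu j
    simp only [hJ]
    linarith
  have hliminf : liminf (fun j => W (u (φ (ψ j)))) atTop
      ≤ liminf (fun j => (J (u (φ (ψ j))) - b j) / α) atTop :=
    liminf_le_liminf (Eventually.of_forall hle)
      (isBoundedUnder_of ⟨-γ, fun j => hγ _ (huD _)⟩)
      hlim.isBoundedUnder_le.isCoboundedUnder_ge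
  rw [hlim.liminf_eq] at hliminf
  have hfin := hW.trans hliminf
  rw [le_div_iff₀ hα] at hfin
  refine ⟨x₀, hx₀, fun x hx => ?_⟩
  have := csInf_le hbdd (Set.mem_image_of_mem J hx)
  simp only [hJ] at this hfin
  linarith

/-- The parallelogram law for the residual at a midpoint. -/
lemma norm_map_midpoint_sub_sq {X Y : Type*} [NormedAddCommGroup X] [NormedSpace ℝ X]
    [NormedAddCommGroup Y] [InnerProductSpace ℝ Y] (T : X →L[ℝ] Y) (y : Y) (p q : X) :
    ‖T ((1 / 2 : ℝ) • p + (1 - 1 / 2 : ℝ) • q) - y‖ ^ 2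
      = (‖T p - y‖ ^ 2 + ‖T q - y‖ ^ 2) / 2 - ‖T p - T q‖ ^ 2 / 4 := by
  have h1 : T ((1 / 2 : ℝ) • p + (1 - 1 / 2 : ℝ) • q) - y
      = (1 / 2 : ℝ) • ((T p - y) + (T q - y)) := by
    simp only [map_add, map_smul]
    module
  have h2 : T p - T q = (T p - y) - (T q - y) := by abel
  rw [h1, h2, norm_smul, mul_pow, Real.norm_eq_abs, sq_abs]
  linarith [parallelogram_law_with_norm ℝ (T p - y) (T q - y)]

/-- Existence (and conditional uniqueness) of a global minimizer of
`J_{W,α}(x) = ‖Tx - y‖² + α W x` on `D` under hypotheses (H1), (I2), (I3)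
(the `T`-`W` versions of (H2), (H3)). -/
theorem existence_uniqueness_generalized_tikhonov_TW_hyps
    {X Y : Type*} [NormedAddCommGroup X] [NormedSpace ℝ X]
    [NormedAddCommGroup Y] [InnerProductSpace ℝ Y]
    (T : X →L[ℝ] Y) (y : Y) (α : ℝ) (hα : 0 < α)
    (D : Set X) (hD : D.Nonempty) (W : X → ℝ)
    -- (H1)
    (H1 : ∃ γ : ℝ, 0 ≤ γ ∧ ∀ x ∈ D, -γ ≤ W x)
    -- (I2)
    (I2 : ∀ x : ℕ → X, (∀ n, x n ∈ D) → (∃ k : ℝ, ∀ n, |‖T (x n)‖ + W (x n)| ≤ k) →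
      ∀ x₀ ∈ D, (∀ f : X →L[ℝ] ℝ, Tendsto (fun n => f (x n)) atTop (𝓝 (f x₀))) →
      ∃ φ : ℕ → ℕ, StrictMono φ ∧ W x₀ ≤ liminf (fun j => W (x (φ j))) atTop)
    -- (I3)
    (I3 : ∀ x : ℕ → X, (∀ n, x n ∈ D) → (∃ k : ℝ, ∀ n, |‖T (x n)‖ + W (x n)| ≤ k) →
      ∃ φ : ℕ → ℕ, StrictMono φ ∧ ∃ x₀ ∈ D,
        ∀ f : X →L[ℝ] ℝ, Tendsto (fun n => f (x (φ n))) atTop (𝓝 (f x₀))) :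
    -- existence of a global minimizer on D
    (∃ xbar ∈ D, ∀ x ∈ D,
      ‖T xbar - y‖ ^ 2 + α * W xbar ≤ ‖T x - y‖ ^ 2 + α * W x) ∧
    -- uniqueness under the additional convexity hypotheses
    (Convex ℝ D →
      (((∀ x ∈ D, ∀ x' ∈ D, ∀ t : ℝ, 0 ≤ t → t ≤ 1 →
            W (t • x + (1 - t) • x') ≤ t * W x + (1 - t) * W x') ∧
          Function.Injective T) ∨
        (∀ x ∈ D, ∀ x' ∈ D, x ≠ x' → ∀ t : ℝ, 0 < t → t < 1 →
            W (t • x + (1 - t) • x') < t * W x + (1 - t) * W x')) →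
      ∃! xbar : X, xbar ∈ D ∧ ∀ x ∈ D,
        ‖T xbar - y‖ ^ 2 + α * W xbar ≤ ‖T x - y‖ ^ 2 + α * W x) := by
  obtain ⟨p, hp, hpmin⟩ := exists_minimizer_generalized_tikhonov T y α hα D hD W H1 I2 I3
  refine ⟨⟨p, hp, hpmin⟩, fun hconv hW => ⟨p, ⟨hp, hpmin⟩, ?_⟩⟩
  rintro q ⟨hq, hqmin⟩
  by_contra hne
  have hmid : (1 / 2 : ℝ) • q + (1 - 1 / 2 : ℝ) • p ∈ D :=
    hconv hq hp (by norm_num) (by norm_num) (by norm_num)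
  have hmin := hpmin _ hmid
  rw [norm_map_midpoint_sub_sq] at hmin
  have hle := hqmin p hp
  rcases hW with ⟨hcvx, hinj⟩ | hstrict
  · have hWm := mul_le_mul_of_nonneg_left
      (hcvx q hq p hp (1 / 2) (by norm_num) (by norm_num)) hα.le
    have hpos : 0 < ‖T q - T p‖ ^ 2 :=
      pow_pos (norm_pos_iff.mpr (sub_ne_zero.mpr (hinj.ne hne))) 2
    linarith
  · have hWm := mul_lt_mul_of_pos_left
      (hstrict q hq p hp hne (1 / 2) (by norm_num) (by norm_num)) hα
    linarith [sq_nonneg ‖T q - T p‖]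
end

section
/- Let X be a real normed vector space, D ⊆ X, and W : D → ℝ a functional satisfying hypotheses (H1) and (H3). Let J, J_n (n = 1, 2, …) be functionals on D such that J is W-subsequentially weakly lower semicontinuous (W-swls), the sequence {J_n} is W-coercive, and {J_n} is W-uniformly consistent for J. Assume that J has a unique global minimizer x̄ ∈ D and that each J_n possesses a global minimizer x_n ∈ D (not necessarily unique). Then x_n converges weakly to x̄. -/
open Filter Topology

/-- If a subsequence of `u ∘ x` tends to infinity, then `x` agrees along that subsequence with a
sequence `y`, all of whose terms are terms of `x`, such that all of `u ∘ y` tends to infinity. -/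
theorem exists_tendsto_atTop_eq_on_subseq {α : Type*} (u : α → ℝ) (x : ℕ → α) {φ : ℕ → ℕ}
    (hφ : StrictMono φ) (h : Tendsto (fun n => u (x (φ n))) atTop atTop) :
    ∃ y : ℕ → α, (∀ n, ∃ m, y n = x m) ∧ (∀ j, y (φ j) = x (φ j)) ∧
      Tendsto (fun n => u (y n)) atTop atTop := by
  classical
  refine ⟨fun n => if n ∈ Set.range φ then x n else x (φ n), fun n => ?_, fun j => ?_, ?_⟩
  · by_cases hn : n ∈ Set.range φ
    · exact ⟨n, by simp only [if_pos hn]⟩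
    · exact ⟨φ n, by simp only [if_neg hn]⟩
  · exact if_pos ⟨j, rfl⟩
  · refine tendsto_atTop.2 fun M => ?_
    obtain ⟨N, hN⟩ := eventually_atTop.1 (tendsto_atTop.1 h M)
    filter_upwards [eventually_ge_atTop (φ N)] with n hn
    by_cases hr : n ∈ Set.range φ
    · simp only [if_pos hr]
      obtain ⟨j, rfl⟩ := hr
      exact hN j (hφ.le_iff_le.1 hn)
    · simp only [if_neg hr]
      exact hN n ((hφ.id_le N).trans hn)

/-- Weak stability of minimizers (Theorem 3.1): if `W` satisfies (H1) and (H3), `J` is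
`W`-swls, `{Jₙ}` is `W`-coercive and `W`-uniformly consistent for `J`, `x̄` is the unique
global minimizer of `J` on `D` and each `xₙ` is a global minimizer of `Jₙ` on `D`, then
`xₙ ⇀ x̄` weakly. -/
theorem weak_stability_minimizers
    {X : Type*} [NormedAddCommGroup X] [NormedSpace ℝ X]
    (D : Set X) (W : X → ℝ) (J : X → ℝ) (Jn : ℕ → X → ℝ)
    -- (H1)
    (H1 : ∃ γ : ℝ, 0 ≤ γ ∧ ∀ x ∈ D, -γ ≤ W x)
    -- (H3)
    (H3 : ∀ x : ℕ → X, (∀ n, x n ∈ D) → (∃ k : ℝ, ∀ n, |W (x n)| ≤ k) →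
      ∃ φ : ℕ → ℕ, StrictMono φ ∧ ∃ x₀ ∈ D,
        ∀ f : X →L[ℝ] ℝ, Tendsto (fun n => f (x (φ n))) atTop (𝓝 (f x₀)))
    -- J is W-subsequentially weakly lower semicontinuous
    (hJswls : ∀ x : ℕ → X, (∀ n, x n ∈ D) → (∃ k : ℝ, ∀ n, |W (x n)| ≤ k) →
      ∀ x₀ ∈ D, (∀ f : X →L[ℝ] ℝ, Tendsto (fun n => f (x n)) atTop (𝓝 (f x₀))) →
      ∃ φ : ℕ → ℕ, StrictMono φ ∧ J x₀ ≤ liminf (fun j => J (x (φ j))) atTop)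
    -- {Jₙ} is W-coercive
    (hcoercive : ∀ x : ℕ → X, (∀ n, x n ∈ D) →
      Tendsto (fun n => W (x n)) atTop atTop →
      Tendsto (fun n => Jn n (x n)) atTop atTop)
    -- {Jₙ} is W-uniformly consistent for J
    (hconsist : ∀ c : ℝ, 0 < c → ∀ ε : ℝ, 0 < ε → ∃ N : ℕ, ∀ n ≥ N, ∀ x ∈ D,
      |W x| ≤ c → |Jn n x - J x| < ε)
    -- x̄ is the unique global minimizer of J on D
    (xbar : X) (hxbarD : xbar ∈ D) (hxbarmin : ∀ x ∈ D, J xbar ≤ J x)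
    (hxbaruniq : ∀ x' ∈ D, (∀ x ∈ D, J x' ≤ J x) → x' = xbar)
    -- each xₙ is a global minimizer of Jₙ on D
    (xn : ℕ → X) (hxnD : ∀ n, xn n ∈ D)
    (hxnmin : ∀ n, ∀ x ∈ D, Jn n (xn n) ≤ Jn n x) :
    ∀ f : X →L[ℝ] ℝ, Tendsto (fun n => f (xn n)) atTop (𝓝 (f xbar)) := by
  obtain ⟨γ, hγ, hW⟩ := H1
  have hJbar : Tendsto (fun n => Jn n xbar) atTop (𝓝 (J xbar)) := by
    refine Metric.tendsto_atTop.2 fun ε hε => ?_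
    obtain ⟨N, hN⟩ := hconsist (|W xbar| + 1) (by positivity) ε hε
    exact ⟨N, fun n hn => hN n hn xbar hxbarD (by linarith)⟩
  have hev : ∃ M : ℝ, ∀ᶠ n in atTop, W (xn n) ≤ M := by
    by_contra! hcon
    obtain ⟨φ, hφ, hφW⟩ := extraction_forall_of_frequently
      (P := fun (n k : ℕ) => (n : ℝ) < W (xn k)) fun n => by simpa using hcon n
    obtain ⟨y, hyx, hyφ, hy⟩ := exists_tendsto_atTop_eq_on_subseq W xn hφ
      (tendsto_atTop_mono (fun n => (hφW n).le) tendsto_natCast_atTop_atTop)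
    have hyD : ∀ n, y n ∈ D := fun n => by
      obtain ⟨m, hm⟩ := hyx n
      exact hm ▸ hxnD m
    have htop := (hcoercive y hyD hy).comp hφ.tendsto_atTop
    refine not_tendsto_nhds_of_tendsto_atTop
      (tendsto_atTop_mono (fun j => ?_) htop) _ (hJbar.comp hφ.tendsto_atTop)
    simpa [hyφ j] using hxnmin (φ j) xbar hxbarD
  obtain ⟨M, hM⟩ := hev
  obtain ⟨k, hk⟩ : ∃ k : ℝ, ∀ n, |W (xn n)| ≤ k := by
    obtain ⟨B, hB⟩ := (isBoundedUnder_of_eventually_le hM).bddAbove_range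
    exact ⟨max γ B, fun n => abs_le.2
      ⟨(neg_le_neg (le_max_left γ B)).trans (hW _ (hxnD n)),
        (hB ⟨n, rfl⟩).trans (le_max_right γ B)⟩⟩
  have hJ : Tendsto (fun n => J (xn n)) atTop (𝓝 (J xbar)) := by
    refine Metric.tendsto_atTop.2 fun ε hε => ?_
    obtain ⟨N₁, hN₁⟩ := hconsist (|k| + 1) (by positivity) (ε / 2) (half_pos hε)
    obtain ⟨N₂, hN₂⟩ := Metric.tendsto_atTop.1 hJbar (ε / 2) (half_pos hε)
    refine ⟨max N₁ N₂, fun n hn => ?_⟩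
    have h₁ := abs_lt.1 (hN₁ n (le_of_max_le_left hn) (xn n) (hxnD n)
      (by linarith [hk n, le_abs_self k]))
    have h₂ := abs_lt.1 (hN₂ n (le_of_max_le_right hn))
    have h₃ := hxnmin n xbar hxbarD
    have h₄ := hxbarmin (xn n) (hxnD n)
    exact abs_lt.2 ⟨by linarith, by linarith⟩
  intro f
  refine tendsto_of_subseq_tendsto fun ns hns => ?_
  obtain ⟨φ, hφ, x₀, hx₀D, hx₀⟩ :=
    H3 (fun n => xn (ns n)) (fun n => hxnD _) ⟨k, fun n => hk _⟩
  obtain ⟨ψ, hψ, hle⟩ := hJswls (fun n => xn (ns (φ n))) (fun n => hxnD _)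
    ⟨k, fun n => hk _⟩ x₀ hx₀D hx₀
  have hlim : Tendsto (fun j => J (xn (ns (φ (ψ j))))) atTop (𝓝 (J xbar)) :=
    hJ.comp (hns.comp (hφ.comp hψ).tendsto_atTop)
  rw [hlim.liminf_eq] at hle
  obtain rfl := hxbaruniq x₀ hx₀D fun x hx => hle.trans (hxbarmin x hx)
  exact ⟨φ, hx₀ f⟩
end

section
/- Let X be a real normed vector space, Y a real inner product space, T, T_n : X → Y (n = 1, 2, …) bounded linear operators, y, y_n ∈ Y, α > 0 and α_n > 0, D ⊆ X, and W : D → ℝ a functional satisfying hypotheses (H1), (H2) and (H3). Define J(x) = ‖Tx − y‖² + α·W(x) and J_n(x) = ‖T_n x − y_n‖² + α_n·W(x) on D. Assume that α_n → α, y_n → y, and {T_n} is W-uniformly consistent for T. Suppose J has a unique global minimizer x̄ ∈ D and for each n, x_n is a global minimizer of J_n on D. Then x_n converges weakly to x̄. -/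
open Filter Topology

/-- If `⟪v₀, v n⟫ → ‖v₀‖ ^ 2`, `w₀ ≤ liminf w` and `a n → a₀ > 0`, then an upper bound
`‖v n‖ ^ 2 + a n * w n ≤ b n` passes to the limit. -/
theorem norm_sq_add_mul_le_of_tendsto_inner {Y : Type*} [NormedAddCommGroup Y]
    [InnerProductSpace ℝ Y] {v : ℕ → Y} {v₀ : Y} {a w b : ℕ → ℝ} {a₀ w₀ b₀ : ℝ}
    (hv : Tendsto (fun n => inner ℝ v₀ (v n)) atTop (𝓝 (‖v₀‖ ^ 2)))
    (ha : Tendsto a atTop (𝓝 a₀)) (ha_pos : ∀ n, 0 < a n) (ha₀ : 0 < a₀)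
    (hw_bdd : IsBoundedUnder (· ≥ ·) atTop w) (hw : w₀ ≤ liminf w atTop)
    (hb : Tendsto b atTop (𝓝 b₀)) (hle : ∀ n, ‖v n‖ ^ 2 + a n * w n ≤ b n) :
    ‖v₀‖ ^ 2 + a₀ * w₀ ≤ b₀ := by
  refine le_of_forall_pos_le_add fun ε hε => ?_
  set δ := ε / a₀ with hδ
  have hδ_pos : 0 < δ := div_pos hε ha₀
  have hlim : Tendsto (fun n => 2 * inner ℝ v₀ (v n) - ‖v₀‖ ^ 2 + a n * (w₀ - δ)) atTop
      (𝓝 (2 * ‖v₀‖ ^ 2 - ‖v₀‖ ^ 2 + a₀ * (w₀ - δ))) :=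
    ((hv.const_mul 2).sub_const _).add (ha.mul_const _)
  have hev : ∀ᶠ n in atTop, w₀ - δ < w n :=
    eventually_lt_of_lt_liminf (lt_of_lt_of_le (by linarith) hw) hw_bdd
  have hlimit := le_of_tendsto_of_tendsto hlim hb <| by
    filter_upwards [hev] with n hn
    have hsq : 0 ≤ ‖v n - v₀‖ ^ 2 := sq_nonneg _
    rw [norm_sub_sq_real, real_inner_comm] at hsq
    have hmul := mul_le_mul_of_nonneg_left hn.le (ha_pos n).le
    linarith [hle n]
  have hεδ : a₀ * δ = ε := by rw [hδ]; field_simp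
  linarith

/-- Weak stability for Tikhonov-Phillips type functionals (Corollary 3.1): if `W`
satisfies (H1), (H2), (H3), `αₙ → α`, `yₙ → y`, `{Tₙ}` is `W`-uniformly consistent for
`T`, `x̄` is the unique global minimizer of `J(x) = ‖Tx - y‖² + α W x` on `D` and each
`xₙ` is a global minimizer of `Jₙ(x) = ‖Tₙx - yₙ‖² + αₙ W x` on `D`, then `xₙ ⇀ x̄`. -/
theorem weak_stability_tikhonov
    {X Y : Type*} [NormedAddCommGroup X] [NormedSpace ℝ X]
    [NormedAddCommGroup Y] [InnerProductSpace ℝ Y]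
    (T : X →L[ℝ] Y) (Tn : ℕ → X →L[ℝ] Y) (y : Y) (yn : ℕ → Y)
    (α : ℝ) (hα : 0 < α) (αn : ℕ → ℝ) (hαn : ∀ n, 0 < αn n)
    (D : Set X) (W : X → ℝ)
    -- (H1)
    (H1 : ∃ γ : ℝ, 0 ≤ γ ∧ ∀ x ∈ D, -γ ≤ W x)
    -- (H2)
    (H2 : ∀ x : ℕ → X, (∀ n, x n ∈ D) → (∃ k : ℝ, ∀ n, |W (x n)| ≤ k) →
      ∀ x₀ ∈ D, (∀ f : X →L[ℝ] ℝ, Tendsto (fun n => f (x n)) atTop (𝓝 (f x₀))) →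
      ∃ φ : ℕ → ℕ, StrictMono φ ∧ W x₀ ≤ liminf (fun j => W (x (φ j))) atTop)
    -- (H3)
    (H3 : ∀ x : ℕ → X, (∀ n, x n ∈ D) → (∃ k : ℝ, ∀ n, |W (x n)| ≤ k) →
      ∃ φ : ℕ → ℕ, StrictMono φ ∧ ∃ x₀ ∈ D,
        ∀ f : X →L[ℝ] ℝ, Tendsto (fun n => f (x (φ n))) atTop (𝓝 (f x₀)))
    -- parameter and data convergence
    (hαconv : Tendsto αn atTop (𝓝 α)) (hyconv : Tendsto yn atTop (𝓝 y))
    -- {Tₙ} is W-uniformly consistent for T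
    (hTconsist : ∀ c : ℝ, 0 < c → ∀ ε : ℝ, 0 < ε → ∃ N : ℕ, ∀ n ≥ N, ∀ x ∈ D,
      |W x| ≤ c → ‖Tn n x - T x‖ < ε)
    -- x̄ is the unique global minimizer of J on D
    (xbar : X) (hxbarD : xbar ∈ D)
    (hxbarmin : ∀ x ∈ D,
      ‖T xbar - y‖ ^ 2 + α * W xbar ≤ ‖T x - y‖ ^ 2 + α * W x)
    (hxbaruniq : ∀ x' ∈ D,
      (∀ x ∈ D, ‖T x' - y‖ ^ 2 + α * W x' ≤ ‖T x - y‖ ^ 2 + α * W x) → x' = xbar)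
    -- each xₙ is a global minimizer of Jₙ on D
    (xn : ℕ → X) (hxnD : ∀ n, xn n ∈ D)
    (hxnmin : ∀ n, ∀ x ∈ D,
      ‖Tn n (xn n) - yn n‖ ^ 2 + αn n * W (xn n) ≤ ‖Tn n x - yn n‖ ^ 2 + αn n * W x) :
    ∀ f : X →L[ℝ] ℝ, Tendsto (fun n => f (xn n)) atTop (𝓝 (f xbar)) := by
  have hTx : ∀ x ∈ D, Tendsto (fun n => Tn n x) atTop (𝓝 (T x)) := by
    intro x hx
    rw [Metric.tendsto_atTop]
    intro ε hε
    obtain ⟨N, hN⟩ := hTconsist (|W x| + 1) (by positivity) ε hε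
    exact ⟨N, fun n hn => by simpa [dist_eq_norm] using hN n hn x hx (by linarith)⟩
  have hJn : ∀ x ∈ D, Tendsto (fun n => ‖Tn n x - yn n‖ ^ 2 + αn n * W x) atTop
      (𝓝 (‖T x - y‖ ^ 2 + α * W x)) := fun x hx =>
    (((hTx x hx).sub hyconv).norm.pow 2).add (hαconv.mul_const _)
  obtain ⟨γ, hγ, hWγ⟩ := H1
  obtain ⟨c, hc_pos, hc⟩ : ∃ c : ℝ, 0 < c ∧ ∀ n, |W (xn n)| ≤ c := by
    obtain ⟨M, hM⟩ := ((hJn xbar hxbarD).div hαconv hα.ne').bddAbove_range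
    refine ⟨max M γ + 1, by linarith [le_max_right M γ], fun n => abs_le.2 ⟨?_, ?_⟩⟩
    · linarith [hWγ _ (hxnD n), le_max_right M γ]
    · have hWn : W (xn n) ≤ (‖Tn n xbar - yn n‖ ^ 2 + αn n * W xbar) / αn n := by
        rw [le_div_iff₀ (hαn n)]
        linarith [hxnmin n xbar hxbarD, sq_nonneg ‖Tn n (xn n) - yn n‖]
      exact (hWn.trans (hM ⟨n, rfl⟩)).trans ((le_max_left M γ).trans (by linarith))
  have hdiff : Tendsto (fun n => Tn n (xn n) - T (xn n)) atTop (𝓝 0) := by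
    rw [Metric.tendsto_atTop]
    intro ε hε
    obtain ⟨N, hN⟩ := hTconsist c hc_pos ε hε
    exact ⟨N, fun n hn => by simpa using hN n hn _ (hxnD n) (hc n)⟩
  intro f
  refine tendsto_of_subseq_tendsto fun ns hns => ?_
  obtain ⟨φ, hφ, x₀, hx₀, hweak⟩ := H3 (fun j => xn (ns j)) (fun _ => hxnD _) ⟨c, fun _ => hc _⟩
  obtain ⟨ψ, hψ, hliminf⟩ :=
    H2 (fun j => xn (ns (φ j))) (fun _ => hxnD _) ⟨c, fun _ => hc _⟩ x₀ hx₀ hweak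
  have hsub : Tendsto (fun j => ns (φ (ψ j))) atTop atTop :=
    hns.comp (hφ.tendsto_atTop.comp hψ.tendsto_atTop)
  have hinner : Tendsto (fun j => inner ℝ (T x₀ - y)
      (Tn (ns (φ (ψ j))) (xn (ns (φ (ψ j)))) - yn (ns (φ (ψ j))))) atTop
      (𝓝 (‖T x₀ - y‖ ^ 2)) := by
    have hTu := (hweak ((innerSL ℝ (T x₀ - y)).comp T)).comp hψ.tendsto_atTop
    have hrest : Tendsto (fun n => inner ℝ (T x₀ - y) (Tn n (xn n) - T (xn n) - yn n)) atTop
        (𝓝 (inner ℝ (T x₀ - y) (0 - y))) :=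
      tendsto_const_nhds.inner (hdiff.sub hyconv)
    have hsum := hTu.add (hrest.comp hsub)
    convert hsum using 2
    · simp only [Function.comp_apply, ContinuousLinearMap.comp_apply, innerSL_apply_apply,
        ← inner_add_right]
      congr 1
      abel
    · rw [← real_inner_self_eq_norm_sq, ContinuousLinearMap.comp_apply, innerSL_apply_apply,
        ← inner_add_right]
      congr 1
      abel
  have hx₀_eq : x₀ = xbar := hxbaruniq x₀ hx₀ fun x hx =>
    norm_sq_add_mul_le_of_tendsto_inner hinner (hαconv.comp hsub) (fun _ => hαn _) hα
      (isBoundedUnder_of ⟨-γ, fun _ => hWγ _ (hxnD _)⟩) hliminf ((hJn x hx).comp hsub)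
      fun _ => hxnmin _ x hx
  exact ⟨φ, hx₀_eq ▸ hweak f⟩
end

section
/- Let X and Y be real normed vector spaces, T : X → Y a bounded linear operator, D ⊆ X, and W : D → ℝ a functional satisfying hypotheses (H1) and (I3). Let J, J_n (n = 1, 2, …) be functionals on D such that J is T-W-subsequentially weakly lower semicontinuous (T-W-swls), the sequence {J_n} is T-W-coercive, and {J_n} is T-W-uniformly consistent for J. Assume that J has a unique global minimizer x̄ ∈ D and that each J_n possesses a global minimizer x_n ∈ D (not necessarily unique). Then x_n converges weakly to x̄. -/
open Filter Topology

/-- If `u` is not bounded above, there is a reindexing `m` along which `u` tends to infinity and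
which fixes infinitely many indices. -/
lemma exists_tendsto_atTop_comp_and_frequently_eq {u : ℕ → ℝ} (hu : ∀ C, ∃ n, C < u n) :
    ∃ m : ℕ → ℕ, Tendsto (fun n => u (m n)) atTop atTop ∧ ∃ᶠ n in atTop, m n = n := by
  have hmax (n : ℕ) : ∃ m ≤ n, ∀ k ≤ n, u k ≤ u m := by
    obtain ⟨m, hm, h⟩ := (Finset.range (n + 1)).exists_max_image u ⟨0, by simp⟩
    exact ⟨m, Nat.lt_succ_iff.mp (Finset.mem_range.mp hm),
      fun k hk => h k (Finset.mem_range.mpr (Nat.lt_succ_iff.mpr hk))⟩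
  choose m hmle hm using hmax
  refine ⟨m, tendsto_atTop.mpr fun C => ?_, ?_⟩
  · obtain ⟨k, hk⟩ := hu C
    filter_upwards [eventually_ge_atTop k] with n hn
    exact hk.le.trans (hm n k hn)
  · refine frequently_atTop.mpr fun N => ?_
    classical
    have hex := hu (u (m N))
    have hspec : u (m N) < u (Nat.find hex) := Nat.find_spec hex
    refine ⟨Nat.find hex, ?_, (hmle _).eq_of_not_lt fun h => ?_⟩
    · by_contra! h
      exact absurd (hm N _ h.le) (not_le.mpr hspec)
    · exact Nat.find_min hex h (hspec.trans_le (hm _ _ le_rfl))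

/-- Weak stability of minimizers, `T`-`W` version (Theorem 3.2): if `W` satisfies (H1)
and (I3), `J` is `T`-`W`-swls, `{Jₙ}` is `T`-`W`-coercive and `T`-`W`-uniformly consistent
for `J`, `x̄` is the unique global minimizer of `J` on `D` and each `xₙ` is a global
minimizer of `Jₙ` on `D`, then `xₙ ⇀ x̄` weakly. -/
theorem weak_stability_minimizers_TW
    {X Y : Type*} [NormedAddCommGroup X] [NormedSpace ℝ X]
    [NormedAddCommGroup Y] [NormedSpace ℝ Y]
    (T : X →L[ℝ] Y) (D : Set X) (W : X → ℝ) (J : X → ℝ) (Jn : ℕ → X → ℝ)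
    -- (H1)
    (H1 : ∃ γ : ℝ, 0 ≤ γ ∧ ∀ x ∈ D, -γ ≤ W x)
    -- (I3)
    (I3 : ∀ x : ℕ → X, (∀ n, x n ∈ D) → (∃ k : ℝ, ∀ n, |‖T (x n)‖ + W (x n)| ≤ k) →
      ∃ φ : ℕ → ℕ, StrictMono φ ∧ ∃ x₀ ∈ D,
        ∀ f : X →L[ℝ] ℝ, Tendsto (fun n => f (x (φ n))) atTop (𝓝 (f x₀)))
    -- J is T-W-subsequentially weakly lower semicontinuous
    (hJswls : ∀ x : ℕ → X, (∀ n, x n ∈ D) → (∃ k : ℝ, ∀ n, |‖T (x n)‖ + W (x n)| ≤ k) →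
      ∀ x₀ ∈ D, (∀ f : X →L[ℝ] ℝ, Tendsto (fun n => f (x n)) atTop (𝓝 (f x₀))) →
      ∃ φ : ℕ → ℕ, StrictMono φ ∧ J x₀ ≤ liminf (fun j => J (x (φ j))) atTop)
    -- {Jₙ} is T-W-coercive
    (hcoercive : ∀ x : ℕ → X, (∀ n, x n ∈ D) →
      Tendsto (fun n => ‖T (x n)‖ + W (x n)) atTop atTop →
      Tendsto (fun n => Jn n (x n)) atTop atTop)
    -- {Jₙ} is T-W-uniformly consistent for J
    (hconsist : ∀ c : ℝ, 0 < c → ∀ ε : ℝ, 0 < ε → ∃ N : ℕ, ∀ n ≥ N, ∀ x ∈ D,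
      ‖T x‖ + |W x| ≤ c → |Jn n x - J x| < ε)
    -- x̄ is the unique global minimizer of J on D
    (xbar : X) (hxbarD : xbar ∈ D) (hxbarmin : ∀ x ∈ D, J xbar ≤ J x)
    (hxbaruniq : ∀ x' ∈ D, (∀ x ∈ D, J x' ≤ J x) → x' = xbar)
    -- each xₙ is a global minimizer of Jₙ on D
    (xn : ℕ → X) (hxnD : ∀ n, xn n ∈ D)
    (hxnmin : ∀ n, ∀ x ∈ D, Jn n (xn n) ≤ Jn n x) :
    ∀ f : X →L[ℝ] ℝ, Tendsto (fun n => f (xn n)) atTop (𝓝 (f xbar)) := by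
  obtain ⟨γ, hγ, hW⟩ := H1
  have hJnbar : Tendsto (fun n => Jn n xbar) atTop (𝓝 (J xbar)) := by
    refine Metric.tendsto_atTop.mpr fun ε hε => ?_
    obtain ⟨N, hN⟩ := hconsist (‖T xbar‖ + |W xbar| + 1) (by positivity) ε hε
    exact ⟨N, fun n hn => hN n hn xbar hxbarD (by linarith)⟩
  obtain ⟨C, hC⟩ : ∃ C, ∀ n, ‖T (xn n)‖ + W (xn n) ≤ C := by
    by_contra! h
    obtain ⟨m, hm, hfix⟩ := exists_tendsto_atTop_comp_and_frequently_eq h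
    have hlarge := (hcoercive (fun n => xn (m n)) (fun n => hxnD _) hm).eventually_gt_atTop
      (J xbar + 1)
    have hsmall := hJnbar.eventually_lt_const (lt_add_one (J xbar))
    obtain ⟨n, hn, hlt, hgt⟩ := (hfix.and_eventually (hsmall.and hlarge)).exists
    rw [hn] at hgt
    linarith [hxnmin n xbar hxbarD]
  have hbdd : ∀ n, |‖T (xn n)‖ + W (xn n)| ≤ |C| + γ := fun n => by
    rw [abs_le]
    have := hW _ (hxnD n)
    have := norm_nonneg (T (xn n))
    constructor <;> linarith [hC n, le_abs_self C, abs_nonneg C]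
  have habs : ∀ n, ‖T (xn n)‖ + |W (xn n)| ≤ |C| + 2 * γ + 1 := fun n => by
    have : |W (xn n)| ≤ W (xn n) + 2 * γ := by
      have := hW _ (hxnD n)
      rw [abs_le]
      constructor <;> linarith
    linarith [hC n, le_abs_self C]
  have hJxn : Tendsto (fun n => J (xn n)) atTop (𝓝 (J xbar)) := by
    have hdiff : Tendsto (fun n => Jn n (xn n) - J (xn n)) atTop (𝓝 0) := by
      refine Metric.tendsto_atTop.mpr fun ε hε => ?_
      obtain ⟨N, hN⟩ := hconsist (|C| + 2 * γ + 1) (by positivity) ε hε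
      refine ⟨N, fun n hn => ?_⟩
      simpa [Real.dist_eq] using hN n hn _ (hxnD n) (habs n)
    refine tendsto_of_tendsto_of_tendsto_of_le_of_le tendsto_const_nhds
      (by simpa using hJnbar.sub hdiff) (fun n => hxbarmin _ (hxnD n)) fun n => ?_
    simp only
    linarith [hxnmin n xbar hxbarD]
  intro f
  refine tendsto_of_subseq_tendsto fun ns hns => ?_
  obtain ⟨φ, hφ, x₀, hx₀, hlim⟩ := I3 (xn ∘ ns) (fun n => hxnD _) ⟨_, fun n => hbdd _⟩
  obtain ⟨ψ, hψ, hle⟩ := hJswls (fun n => xn (ns (φ n))) (fun n => hxnD _)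
    ⟨_, fun n => hbdd _⟩ x₀ hx₀ hlim
  have hJsub : Tendsto (fun j => J (xn (ns (φ (ψ j))))) atTop (𝓝 (J xbar)) :=
    hJxn.comp (hns.comp (hφ.tendsto_atTop.comp hψ.tendsto_atTop))
  rw [hJsub.liminf_eq] at hle
  obtain rfl := hxbaruniq x₀ hx₀ fun x hx => hle.trans (hxbarmin x hx)
  exact ⟨φ, hlim f⟩
end

section
/- Let X be a real normed vector space, Y a real inner product space, T, T_n : X → Y (n = 1, 2, …) bounded linear operators, y, y_n ∈ Y, α > 0 and α_n > 0, D ⊆ X, and W : D → ℝ a functional satisfying hypotheses (H1), (I2) and (I3). Define J(x) = ‖Tx − y‖² + α·W(x) and J_n(x) = ‖T_n x − y_n‖² + α_n·W(x) on D. Assume that α_n → α, y_n → y, and {T_n} is W-uniformly consistent for T. Suppose J has a unique global minimizer x̄ ∈ D and for each n, x_n is a global minimizer of J_n on D. Then x_n converges weakly to x̄. -/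
open Filter Topology

/-- Weak stability for Tikhonov-Phillips type functionals (Corollary 3.2): if `W`
satisfies (H1), (I2), (I3), `αₙ → α`, `yₙ → y`, `{Tₙ}` is `W`-uniformly consistent for
`T`, `x̄` is the unique global minimizer of `J(x) = ‖Tx - y‖² + α W x` on `D` and each
`xₙ` is a global minimizer of `Jₙ(x) = ‖Tₙx - yₙ‖² + αₙ W x` on `D`, then `xₙ ⇀ x̄`. -/
theorem weak_stability_tikhonov_TW
    {X Y : Type*} [NormedAddCommGroup X] [NormedSpace ℝ X]
    [NormedAddCommGroup Y] [InnerProductSpace ℝ Y]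
    (T : X →L[ℝ] Y) (Tn : ℕ → X →L[ℝ] Y) (y : Y) (yn : ℕ → Y)
    (α : ℝ) (hα : 0 < α) (αn : ℕ → ℝ) (hαn : ∀ n, 0 < αn n)
    (D : Set X) (W : X → ℝ)
    -- (H1)
    (H1 : ∃ γ : ℝ, 0 ≤ γ ∧ ∀ x ∈ D, -γ ≤ W x)
    -- (I2)
    (I2 : ∀ x : ℕ → X, (∀ n, x n ∈ D) → (∃ k : ℝ, ∀ n, |‖T (x n)‖ + W (x n)| ≤ k) →
      ∀ x₀ ∈ D, (∀ f : X →L[ℝ] ℝ, Tendsto (fun n => f (x n)) atTop (𝓝 (f x₀))) →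
      ∃ φ : ℕ → ℕ, StrictMono φ ∧ W x₀ ≤ liminf (fun j => W (x (φ j))) atTop)
    -- (I3)
    (I3 : ∀ x : ℕ → X, (∀ n, x n ∈ D) → (∃ k : ℝ, ∀ n, |‖T (x n)‖ + W (x n)| ≤ k) →
      ∃ φ : ℕ → ℕ, StrictMono φ ∧ ∃ x₀ ∈ D,
        ∀ f : X →L[ℝ] ℝ, Tendsto (fun n => f (x (φ n))) atTop (𝓝 (f x₀)))
    -- parameter and data convergence
    (hαconv : Tendsto αn atTop (𝓝 α)) (hyconv : Tendsto yn atTop (𝓝 y))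
    -- {Tₙ} is W-uniformly consistent for T
    (hTconsist : ∀ c : ℝ, 0 < c → ∀ ε : ℝ, 0 < ε → ∃ N : ℕ, ∀ n ≥ N, ∀ x ∈ D,
      |W x| ≤ c → ‖Tn n x - T x‖ < ε)
    -- x̄ is the unique global minimizer of J on D
    (xbar : X) (hxbarD : xbar ∈ D)
    (hxbarmin : ∀ x ∈ D,
      ‖T xbar - y‖ ^ 2 + α * W xbar ≤ ‖T x - y‖ ^ 2 + α * W x)
    (hxbaruniq : ∀ x' ∈ D,
      (∀ x ∈ D, ‖T x' - y‖ ^ 2 + α * W x' ≤ ‖T x - y‖ ^ 2 + α * W x) → x' = xbar)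
    -- each xₙ is a global minimizer of Jₙ on D
    (xn : ℕ → X) (hxnD : ∀ n, xn n ∈ D)
    (hxnmin : ∀ n, ∀ x ∈ D,
      ‖Tn n (xn n) - yn n‖ ^ 2 + αn n * W (xn n) ≤ ‖Tn n x - yn n‖ ^ 2 + αn n * W x) :
    ∀ f : X →L[ℝ] ℝ, Tendsto (fun n => f (xn n)) atTop (𝓝 (f xbar)) := by
  obtain ⟨γ, hγ, hWγ⟩ := H1
  have hTxbar : Tendsto (fun n => Tn n xbar) atTop (𝓝 (T xbar)) := by
    rw [Metric.tendsto_atTop]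
    intro ε hε
    obtain ⟨N, hN⟩ := hTconsist (|W xbar| + 1) (by positivity) ε hε
    exact ⟨N, fun n hn => by
      rw [dist_eq_norm]
      exact hN n hn xbar hxbarD (by linarith)⟩
  have hJbar : Tendsto (fun n => ‖Tn n xbar - yn n‖ ^ 2 + αn n * W xbar) atTop
      (𝓝 (‖T xbar - y‖ ^ 2 + α * W xbar)) :=
    ((hTxbar.sub hyconv).norm.pow 2).add (hαconv.mul_const _)
  obtain ⟨C, hC, hWC⟩ : ∃ C : ℝ, 0 < C ∧ ∀ n, |W (xn n)| ≤ C := by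
    obtain ⟨K, hK⟩ := (hJbar.div hαconv hα.ne').bddAbove_range
    refine ⟨max K γ + 1, by linarith [le_max_right K γ], fun n => abs_le.2 ⟨?_, ?_⟩⟩
    · linarith [hWγ _ (hxnD n), le_max_right K γ]
    · have h1 := hK ⟨n, rfl⟩
      have h2 : W (xn n) ≤ (‖Tn n xbar - yn n‖ ^ 2 + αn n * W xbar) / αn n := by
        rw [le_div_iff₀ (hαn n)]
        nlinarith [hxnmin n xbar hxbarD, sq_nonneg ‖Tn n (xn n) - yn n‖]
      exact (h2.trans h1).trans (by linarith [le_max_left K γ])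
  have hTdiff : Tendsto (fun n => Tn n (xn n) - T (xn n)) atTop (𝓝 0) := by
    rw [Metric.tendsto_atTop]
    intro ε hε
    obtain ⟨N, hN⟩ := hTconsist C hC ε hε
    exact ⟨N, fun n hn => by
      rw [dist_zero_right]
      exact hN n hn _ (hxnD n) (hWC n)⟩
  have hres : Tendsto (fun n => (T (xn n) - y) - (Tn n (xn n) - yn n)) atTop (𝓝 0) := by
    have h := (hyconv.sub_const y).sub hTdiff
    rw [sub_self, sub_zero] at h
    exact h.congr fun n => by abel
  obtain ⟨B, hB⟩ : ∃ B : ℝ, ∀ n, ‖Tn n (xn n) - yn n‖ ≤ B := by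
    obtain ⟨K, hK⟩ := (hJbar.add (hαconv.mul_const γ)).bddAbove_range
    refine ⟨K + 1, fun n => ?_⟩
    have h1 := hK ⟨n, rfl⟩
    dsimp only at h1
    nlinarith [hxnmin n xbar hxbarD, mul_le_mul_of_nonneg_left (hWγ _ (hxnD n)) (hαn n).le,
      sq_nonneg (‖Tn n (xn n) - yn n‖ - 1)]
  obtain ⟨E, hE⟩ := hres.norm.bddAbove_range
  replace hE : ∀ n, ‖(T (xn n) - y) - (Tn n (xn n) - yn n)‖ ≤ E := fun n => hE ⟨n, rfl⟩
  have hv : ∀ n, ‖T (xn n) - y‖ ≤ B + E := fun n => by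
    have := norm_le_norm_add_norm_sub' (T (xn n) - y) (Tn n (xn n) - yn n)
    linarith [hB n, hE n]
  have hbdd : ∀ n, |‖T (xn n)‖ + W (xn n)| ≤ B + E + ‖y‖ + C := fun n => by
    have h1 := norm_le_norm_add_norm_sub' (T (xn n)) y
    have h2 := abs_add_le ‖T (xn n)‖ (W (xn n))
    rw [abs_norm] at h2
    linarith [hv n, hWC n]
  have hsq : Tendsto (fun n => ‖T (xn n) - y‖ ^ 2 - ‖Tn n (xn n) - yn n‖ ^ 2) atTop (𝓝 0) := by
    have h0 := hres.norm.mul_const (B + E + B)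
    rw [norm_zero, zero_mul] at h0
    refine squeeze_zero_norm (fun n => ?_) h0
    rw [Real.norm_eq_abs, sq_sub_sq, abs_mul, mul_comm]
    refine mul_le_mul (abs_norm_sub_norm_le _ _) ?_ (abs_nonneg _) (norm_nonneg _)
    rw [abs_of_nonneg (by positivity)]
    linarith [hv n, hB n]
  have hαW : Tendsto (fun n => (α - αn n) * W (xn n)) atTop (𝓝 0) := by
    have h0 := ((hαconv.const_sub α).abs).mul_const C
    rw [sub_self, abs_zero, zero_mul] at h0
    refine squeeze_zero_norm (fun n => ?_) h0
    rw [Real.norm_eq_abs, abs_mul]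
    exact mul_le_mul_of_nonneg_left (hWC n) (abs_nonneg _)
  obtain ⟨L, hL, hJL⟩ : ∃ L : ℕ → ℝ,
      Tendsto L atTop (𝓝 (‖T xbar - y‖ ^ 2 + α * W xbar)) ∧
      ∀ n, ‖T (xn n) - y‖ ^ 2 + α * W (xn n) ≤ L n := by
    have h := (hJbar.add hsq).add hαW
    rw [add_zero, add_zero] at h
    exact ⟨_, h, fun n => by linarith [hxnmin n xbar hxbarD]⟩
  intro f
  refine tendsto_of_subseq_tendsto fun ns hns => ?_
  obtain ⟨φ, hφ, x₀, hx₀, hweak⟩ :=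
    I3 (fun n => xn (ns n)) (fun n => hxnD _) ⟨_, fun n => hbdd _⟩
  obtain ⟨ψ, hψ, hliminf⟩ := I2 (fun n => xn (ns (φ n))) (fun n => hxnD _)
    ⟨_, fun n => hbdd _⟩ x₀ hx₀ hweak
  suffices h : x₀ = xbar from ⟨φ, h ▸ hweak f⟩
  refine hxbaruniq x₀ hx₀ fun x hx => le_trans ?_ (hxbarmin x hx)
  have hsub : Tendsto (fun j => ns (φ (ψ j))) atTop atTop :=
    hns.comp (hφ.tendsto_atTop.comp hψ.tendsto_atTop)
  have hinner : Tendsto (fun j => inner ℝ (T x₀ - y) (T (xn (ns (φ (ψ j)))) - y)) atTop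
      (𝓝 (‖T x₀ - y‖ ^ 2)) := by
    have h := ((hweak ((innerSL ℝ (T x₀ - y)).comp T)).comp hψ.tendsto_atTop).sub_const
      (inner ℝ (T x₀ - y) y)
    rw [← real_inner_self_eq_norm_sq]
    convert h using 2
    · exact inner_sub_right _ _ _
    · exact inner_sub_right _ _ _
  have hupper := ((hL.comp hsub).sub ((hinner.const_mul 2).sub_const (‖T x₀ - y‖ ^ 2))).div_const α
  have hWle : ∀ j, W (xn (ns (φ (ψ j)))) ≤ ((L ∘ fun j => ns (φ (ψ j))) j -
      (2 * inner ℝ (T x₀ - y) (T (xn (ns (φ (ψ j)))) - y) - ‖T x₀ - y‖ ^ 2)) / α := fun j => by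
    rw [le_div_iff₀ hα]
    have h := norm_sub_sq_real (T x₀ - y) (T (xn (ns (φ (ψ j)))) - y)
    have h' := hJL (ns (φ (ψ j)))
    simp only [Function.comp_apply]
    nlinarith [sq_nonneg ‖(T x₀ - y) - (T (xn (ns (φ (ψ j)))) - y)‖]
  have hle := liminf_le_liminf (Eventually.of_forall hWle)
    (isBoundedUnder_of ⟨-C, fun j => (abs_le.1 (hWC _)).1⟩) hupper.isBoundedUnder_le.isCoboundedUnder_ge
  rw [hupper.liminf_eq] at hle
  have hfin := hliminf.trans hle
  rw [le_div_iff₀ hα] at hfin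
  linarith
end

section
/- Let X be a real normed vector space, D ⊆ X, and W : D → ℝ a functional satisfying hypotheses (H1) and (H3'). Let J, J_n (n = 1, 2, …) be functionals on D such that J is W-subsequentially lower semicontinuous (W-sls), the sequence {J_n} is W-coercive, and {J_n} is W-uniformly consistent for J. Assume that J has a unique global minimizer x̄ ∈ D and that each J_n possesses a global minimizer x_n ∈ D (not necessarily unique). Then x_n converges to x̄ in norm. -/
open Filter Topology

/-- A real sequence that is not bounded above has a subsequence tending to `+∞`, and this
subsequence can be spread out to a full sequence: there is a reindexing `θ` fixing infinitely
many indices along which the sequence tends to `+∞`. -/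
theorem exists_reindex_tendsto_atTop_of_not_bddAbove {w : ℕ → ℝ}
    (hw : ¬ BddAbove (Set.range w)) :
    ∃ θ : ℕ → ℕ, Tendsto (w ∘ θ) atTop atTop ∧ ∃ᶠ n in atTop, θ n = n := by
  have hfreq : ∀ k : ℕ, ∃ᶠ n in atTop, (k : ℝ) ≤ w n := by
    intro k hk
    refine hw (IsBoundedUnder.bddAbove_range ⟨(k : ℝ), ?_⟩)
    rw [eventually_map]
    filter_upwards [hk] with n hn using (not_le.mp hn).le
  obtain ⟨φ, hφ, hwφ⟩ := extraction_forall_of_frequently hfreq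
  let ψ : ℕ → ℕ := fun m => sInf {k | m ≤ φ k}
  have hψ_mem : ∀ m, m ≤ φ (ψ m) := fun m =>
    Nat.sInf_mem (s := {k | m ≤ φ k}) ⟨m, hφ.id_le m⟩
  have hψφ : ∀ k, ψ (φ k) = k := fun k =>
    le_antisymm (Nat.sInf_le (le_refl (φ k))) (hφ.le_iff_le.mp (hψ_mem (φ k)))
  have hψ_mono : Monotone ψ := fun a b hab => Nat.sInf_le (hab.trans (hψ_mem b))
  have hψ : Tendsto ψ atTop atTop :=
    tendsto_atTop_atTop_of_monotone hψ_mono fun k => ⟨φ k, (hψφ k).ge⟩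
  refine ⟨φ ∘ ψ, ?_, ?_⟩
  · exact (tendsto_atTop_mono hwφ tendsto_natCast_atTop_atTop).comp hψ
  · exact hφ.tendsto_atTop.frequently (Frequently.of_forall fun k => by simp [hψφ])

/-- Strong stability of minimizers (Theorem 3.3): if `W` satisfies (H1) and (H3'),
`J` is `W`-sls, `{Jₙ}` is `W`-coercive and `W`-uniformly consistent for `J`, `x̄` is the
unique global minimizer of `J` on `D` and each `xₙ` is a global minimizer of `Jₙ` on `D`,
then `xₙ → x̄` in norm. -/
theorem strong_stability_minimizers
    {X : Type*} [NormedAddCommGroup X] [NormedSpace ℝ X]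
    (D : Set X) (W : X → ℝ) (J : X → ℝ) (Jn : ℕ → X → ℝ)
    -- (H1)
    (H1 : ∃ γ : ℝ, 0 ≤ γ ∧ ∀ x ∈ D, -γ ≤ W x)
    -- (H3')
    (H3' : ∀ x : ℕ → X, (∀ n, x n ∈ D) → (∃ k : ℝ, ∀ n, |W (x n)| ≤ k) →
      ∃ φ : ℕ → ℕ, StrictMono φ ∧ ∃ x₀ ∈ D, Tendsto (x ∘ φ) atTop (𝓝 x₀))
    -- J is W-subsequentially lower semicontinuous
    (hJsls : ∀ x : ℕ → X, (∀ n, x n ∈ D) → (∃ k : ℝ, ∀ n, |W (x n)| ≤ k) →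
      ∀ x₀ ∈ D, Tendsto x atTop (𝓝 x₀) →
      ∃ φ : ℕ → ℕ, StrictMono φ ∧ J x₀ ≤ liminf (fun j => J (x (φ j))) atTop)
    -- {Jₙ} is W-coercive
    (hcoercive : ∀ x : ℕ → X, (∀ n, x n ∈ D) →
      Tendsto (fun n => W (x n)) atTop atTop →
      Tendsto (fun n => Jn n (x n)) atTop atTop)
    -- {Jₙ} is W-uniformly consistent for J
    (hconsist : ∀ c : ℝ, 0 < c → ∀ ε : ℝ, 0 < ε → ∃ N : ℕ, ∀ n ≥ N, ∀ x ∈ D,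
      |W x| ≤ c → |Jn n x - J x| < ε)
    -- x̄ is the unique global minimizer of J on D
    (xbar : X) (hxbarD : xbar ∈ D) (hxbarmin : ∀ x ∈ D, J xbar ≤ J x)
    (hxbaruniq : ∀ x' ∈ D, (∀ x ∈ D, J x' ≤ J x) → x' = xbar)
    -- each xₙ is a global minimizer of Jₙ on D
    (xn : ℕ → X) (hxnD : ∀ n, xn n ∈ D)
    (hxnmin : ∀ n, ∀ x ∈ D, Jn n (xn n) ≤ Jn n x) :
    Tendsto xn atTop (𝓝 xbar) := by
  have hlim : Tendsto (fun n => Jn n xbar) atTop (𝓝 (J xbar)) := by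
    rw [Metric.tendsto_atTop]
    intro ε hε
    obtain ⟨N, hN⟩ := hconsist (|W xbar| + 1) (by positivity) ε hε
    exact ⟨N, fun n hn => hN n hn xbar hxbarD (by linarith)⟩
  have hbdd : BddAbove (Set.range fun n => W (xn n)) := by
    by_contra hunb
    obtain ⟨θ, hθ, hfix⟩ := exists_reindex_tendsto_atTop_of_not_bddAbove hunb
    have hlarge := (hcoercive (xn ∘ θ) (fun n => hxnD _) hθ).eventually_gt_atTop (J xbar + 1)
    have hsmall := hlim.eventually_lt_const (lt_add_one (J xbar))
    obtain ⟨n, hn, hgt, hlt⟩ := (hfix.and_eventually (hlarge.and hsmall)).exists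
    rw [Function.comp_apply, hn] at hgt
    linarith [hxnmin n xbar hxbarD]
  obtain ⟨k, hk⟩ : ∃ k : ℝ, ∀ n, |W (xn n)| ≤ k := by
    obtain ⟨γ, -, hγ⟩ := H1
    obtain ⟨b, hb⟩ := hbdd
    refine ⟨max b γ, fun n => abs_le'.mpr ⟨?_, ?_⟩⟩
    · exact (hb (Set.mem_range_self n)).trans (le_max_left b γ)
    · exact (neg_le.mp (hγ _ (hxnD n))).trans (le_max_right b γ)
  have hJ : Tendsto (fun n => J (xn n)) atTop (𝓝 (J xbar)) := by
    rw [Metric.tendsto_atTop]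
    intro ε hε
    obtain ⟨N, hN⟩ := hconsist (max k 1) (by positivity) (ε / 2) (half_pos hε)
    obtain ⟨M, hM⟩ := Metric.tendsto_atTop.mp hlim (ε / 2) (half_pos hε)
    refine ⟨max N M, fun n hn => ?_⟩
    have hxn := abs_lt.mp
      (hN n (le_of_max_le_left hn) (xn n) (hxnD n) ((hk n).trans (le_max_left k 1)))
    have hxbar := abs_lt.mp (hM n (le_of_max_le_right hn))
    rw [Real.dist_eq, abs_lt]
    constructor <;> linarith [hxnmin n xbar hxbarD, hxbarmin (xn n) (hxnD n)]
  refine tendsto_of_subseq_tendsto fun ns hns => ?_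
  obtain ⟨φ, hφ, x₀, hx₀D, hx₀⟩ := H3' (xn ∘ ns) (fun n => hxnD _) ⟨k, fun n => hk _⟩
  obtain ⟨ψ, hψ, hle⟩ :=
    hJsls (xn ∘ ns ∘ φ) (fun n => hxnD _) ⟨k, fun n => hk _⟩ x₀ hx₀D hx₀
  have hliminf : liminf (fun j => J ((xn ∘ ns ∘ φ) (ψ j))) atTop = J xbar :=
    (hJ.comp (hns.comp (hφ.tendsto_atTop.comp hψ.tendsto_atTop))).liminf_eq
  have hx₀_eq : x₀ = xbar :=
    hxbaruniq x₀ hx₀D fun x hx => (hle.trans hliminf.le).trans (hxbarmin x hx)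
  exact ⟨φ, hx₀_eq ▸ hx₀⟩
end

section
/- Let X be a real normed vector space, Y a real inner product space, T, T_n : X → Y (n = 1, 2, …) bounded linear operators, y, y_n ∈ Y, α > 0 and α_n > 0, D ⊆ X, and W : D → ℝ a functional satisfying hypotheses (H1), (H2') and (H3'). Define J(x) = ‖Tx − y‖² + α·W(x) and J_n(x) = ‖T_n x − y_n‖² + α_n·W(x) on D. Assume that α_n → α, y_n → y, and {T_n} is W-uniformly consistent for T. Suppose J has a unique global minimizer x̄ ∈ D and for each n, x_n is a global minimizer of J_n on D. Then x_n converges to x̄ in norm. -/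
open Filter Topology

/-- If `Tn` converges to `T` uniformly on a set containing the sequence `u`, and `u` converges to
`a`, then `Tn (m j) (u j)` converges to `T a` along any sequence of indices `m`. -/
lemma tendsto_apply_of_uniform {X Y : Type*} [NormedAddCommGroup X] [NormedSpace ℝ X]
    [NormedAddCommGroup Y] [NormedSpace ℝ Y] {T : X →L[ℝ] Y} {Tn : ℕ → X →L[ℝ] Y} {S : Set X}
    (h : ∀ ε : ℝ, 0 < ε → ∃ N : ℕ, ∀ n ≥ N, ∀ x ∈ S, ‖Tn n x - T x‖ < ε)
    {m : ℕ → ℕ} (hm : Tendsto m atTop atTop) {u : ℕ → X} (hu : ∀ j, u j ∈ S) {a : X}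
    (ha : Tendsto u atTop (𝓝 a)) :
    Tendsto (fun j => Tn (m j) (u j)) atTop (𝓝 (T a)) := by
  have hdiff : Tendsto (fun j => Tn (m j) (u j) - T (u j)) atTop (𝓝 0) := by
    rw [NormedAddGroup.tendsto_nhds_zero]
    intro ε hε
    obtain ⟨N, hN⟩ := h ε hε
    filter_upwards [hm.eventually_ge_atTop N] with j hj using hN _ hj _ (hu j)
  simpa using hdiff.add ((T.continuous.tendsto a).comp ha)

/-- Weak stability for Tikhonov-Phillips type functionals (Corollary 3.3): if `W`
satisfies (H1), (H2'), (H3'), `αₙ → α`, `yₙ → y`, `{Tₙ}` is `W`-uniformly consistent for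
`T`, `x̄` is the unique global minimizer of `J(x) = ‖Tx - y‖² + α W x` on `D` and each
`xₙ` is a global minimizer of `Jₙ(x) = ‖Tₙx - yₙ‖² + αₙ W x` on `D`, then `xₙ → x̄` in norm. -/
theorem strong_stability_tikhonov
    {X Y : Type*} [NormedAddCommGroup X] [NormedSpace ℝ X]
    [NormedAddCommGroup Y] [InnerProductSpace ℝ Y]
    (T : X →L[ℝ] Y) (Tn : ℕ → X →L[ℝ] Y) (y : Y) (yn : ℕ → Y)
    (α : ℝ) (hα : 0 < α) (αn : ℕ → ℝ) (hαn : ∀ n, 0 < αn n)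
    (D : Set X) (W : X → ℝ)
    -- (H1)
    (H1 : ∃ γ : ℝ, 0 ≤ γ ∧ ∀ x ∈ D, -γ ≤ W x)
    -- (H2')
    (H2' : ∀ x : ℕ → X, (∀ n, x n ∈ D) → (∃ k : ℝ, ∀ n, |W (x n)| ≤ k) →
      ∀ x₀ ∈ D, Tendsto x atTop (𝓝 x₀) →
      ∃ φ : ℕ → ℕ, StrictMono φ ∧ W x₀ ≤ liminf (fun j => W (x (φ j))) atTop)
    -- (H3')
    (H3' : ∀ x : ℕ → X, (∀ n, x n ∈ D) → (∃ k : ℝ, ∀ n, |W (x n)| ≤ k) →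
      ∃ φ : ℕ → ℕ, StrictMono φ ∧ ∃ x₀ ∈ D, Tendsto (x ∘ φ) atTop (𝓝 x₀))
    -- parameter and data convergence
    (hαconv : Tendsto αn atTop (𝓝 α)) (hyconv : Tendsto yn atTop (𝓝 y))
    -- {Tₙ} is W-uniformly consistent for T
    (hTconsist : ∀ c : ℝ, 0 < c → ∀ ε : ℝ, 0 < ε → ∃ N : ℕ, ∀ n ≥ N, ∀ x ∈ D,
      |W x| ≤ c → ‖Tn n x - T x‖ < ε)
    -- x̄ is the unique global minimizer of J on D
    (xbar : X) (hxbarD : xbar ∈ D)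
    (hxbarmin : ∀ x ∈ D,
      ‖T xbar - y‖ ^ 2 + α * W xbar ≤ ‖T x - y‖ ^ 2 + α * W x)
    (hxbaruniq : ∀ x' ∈ D,
      (∀ x ∈ D, ‖T x' - y‖ ^ 2 + α * W x' ≤ ‖T x - y‖ ^ 2 + α * W x) → x' = xbar)
    -- each xₙ is a global minimizer of Jₙ on D
    (xn : ℕ → X) (hxnD : ∀ n, xn n ∈ D)
    (hxnmin : ∀ n, ∀ x ∈ D,
      ‖Tn n (xn n) - yn n‖ ^ 2 + αn n * W (xn n) ≤ ‖Tn n x - yn n‖ ^ 2 + αn n * W x) :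
    Tendsto xn atTop (𝓝 xbar) := by
  obtain ⟨γ, -, hγ⟩ := H1
  have hpoint : ∀ x ∈ D, Tendsto (fun n => Tn n x) atTop (𝓝 (T x)) := fun x hx =>
    tendsto_apply_of_uniform (S := {z | z ∈ D ∧ |W z| ≤ |W x| + 1})
      (fun ε hε => (hTconsist (|W x| + 1) (by positivity) ε hε).imp
        fun N hN n hn z hz => hN n hn z hz.1 hz.2)
      tendsto_id (u := fun _ => x) (fun _ => ⟨hx, by linarith⟩) tendsto_const_nhds
  have hJ : ∀ x ∈ D, Tendsto (fun n => ‖Tn n x - yn n‖ ^ 2 + αn n * W x) atTop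
      (𝓝 (‖T x - y‖ ^ 2 + α * W x)) := fun x hx =>
    (((hpoint x hx).sub hyconv).norm.pow 2).add (hαconv.mul_const _)
  obtain ⟨k, hk0, hk⟩ : ∃ k : ℝ, 0 < k ∧ ∀ n, |W (xn n)| ≤ k := by
    obtain ⟨B, hB⟩ := ((hJ xbar hxbarD).div hαconv hα.ne').bddAbove_range
    refine ⟨max 1 (max B γ), by positivity, fun n => abs_le.2 ⟨?_, ?_⟩⟩
    · have := hγ _ (hxnD n)
      have := (le_max_right B γ).trans (le_max_right 1 _)
      linarith
    · refine le_trans ?_ ((le_max_left B γ).trans (le_max_right 1 _))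
      refine le_trans ?_ (hB ⟨n, rfl⟩)
      rw [Pi.div_apply, le_div_iff₀ (hαn n)]
      nlinarith [hxnmin n xbar hxbarD, sq_nonneg ‖Tn n (xn n) - yn n‖]
  refine tendsto_of_subseq_tendsto fun ns hns => ?_
  obtain ⟨φ, hφ, x₀, hx₀, hlim⟩ := H3' (xn ∘ ns) (fun n => hxnD _) ⟨k, fun n => hk _⟩
  refine ⟨φ, ?_⟩
  obtain ⟨ψ, hψ, hW⟩ := H2' _ (fun n => hxnD _) ⟨k, fun n => hk _⟩ x₀ hx₀ hlim
  suffices hx : x₀ = xbar from hx ▸ hlim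
  refine hxbaruniq x₀ hx₀ fun x hx => ?_
  have hm : Tendsto (fun j => ns (φ (ψ j))) atTop atTop :=
    hns.comp (hφ.tendsto_atTop.comp hψ.tendsto_atTop)
  have hT := tendsto_apply_of_uniform (S := {z | z ∈ D ∧ |W z| ≤ k})
    (fun ε hε => (hTconsist k hk0 ε hε).imp fun N hN n hn z hz => hN n hn z hz.1 hz.2)
    hm (u := fun j => xn (ns (φ (ψ j)))) (fun j => ⟨hxnD _, hk _⟩)
    (hlim.comp hψ.tendsto_atTop)
  have hlow : ∀ c < W x₀, ‖T x₀ - y‖ ^ 2 + α * c ≤ ‖T x - y‖ ^ 2 + α * W x := by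
    intro c hc
    have hev : ∀ᶠ j in atTop, c < W (xn (ns (φ (ψ j)))) :=
      eventually_lt_of_lt_liminf (hc.trans_le hW)
        (isBoundedUnder_of ⟨-k, fun j => (abs_le.1 (hk _)).1⟩)
    refine le_of_tendsto_of_tendsto
      (((hT.sub (hyconv.comp hm)).norm.pow 2).add ((hαconv.comp hm).mul_const c))
      ((hJ x hx).comp hm) ?_
    filter_upwards [hev] with j hj
    refine le_trans ?_ (hxnmin _ x hx)
    exact add_le_add_right (mul_le_mul_of_nonneg_left hj.le (hαn _).le) _
  have hWle : W x₀ ≤ (‖T x - y‖ ^ 2 + α * W x - ‖T x₀ - y‖ ^ 2) / α := by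
    refine le_of_forall_lt_imp_le_of_dense fun c hc => ?_
    rw [le_div_iff₀ hα]
    linarith [hlow c hc]
  rw [le_div_iff₀ hα] at hWle
  linarith
end

section
/- Let X and Y be real normed vector spaces, T : X → Y a bounded linear operator, D ⊆ X, and W : D → ℝ a functional satisfying hypotheses (H1) and (I3'). Let J, J_n (n = 1, 2, …) be functionals on D such that J is T-W-subsequentially lower semicontinuous (T-W-sls), the sequence {J_n} is T-W-coercive, and {J_n} is T-W-uniformly consistent for J. Assume that J has a unique global minimizer x̄ ∈ D and that each J_n possesses a global minimizer x_n ∈ D (not necessarily unique). Then x_n converges to x̄ in norm. -/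
open Filter Topology

/-- A sequence in `D` along which `F` is dominated by a convergent sequence stays in a sublevel set
of `g`, provided `F` is coercive on `D` with respect to `g`. -/
lemma bddAbove_range_of_coercive {α : Type*} {D : Set α} {g : α → ℝ} {F : ℕ → α → ℝ}
    (hF : ∀ x : ℕ → α, (∀ n, x n ∈ D) → Tendsto (fun n => g (x n)) atTop atTop →
      Tendsto (fun n => F n (x n)) atTop atTop)
    {x : ℕ → α} (hx : ∀ n, x n ∈ D) {u : ℕ → ℝ} {l : ℝ} (hu : Tendsto u atTop (𝓝 l))
    (hle : ∀ᶠ n in atTop, F n (x n) ≤ u n) :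
    BddAbove (Set.range fun n => g (x n)) := by
  classical
  by_contra hunb
  have hfreq : ∀ k : ℕ, ∃ᶠ n in atTop, (k : ℝ) < g (x n) := by
    intro k hk
    refine hunb (IsBoundedUnder.bddAbove_range ⟨k, ?_⟩)
    exact eventually_map.2 (hk.mono fun n hn => not_lt.1 hn)
  obtain ⟨φ, hφ, hgφ⟩ := extraction_forall_of_frequently hfreq
  let y : ℕ → α := fun n => if n ∈ Set.range φ then x n else x (φ n)
  have hyφ (k : ℕ) : y (φ k) = x (φ k) := if_pos ⟨k, rfl⟩
  have hy : Tendsto (fun n => g (y n)) atTop atTop := by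
    refine tendsto_atTop.2 fun b => ?_
    obtain ⟨K, hK⟩ := exists_nat_ge b
    filter_upwards [eventually_ge_atTop (φ K)] with n hn
    by_cases h : n ∈ Set.range φ
    · obtain ⟨k, rfl⟩ := h
      rw [hyφ]
      have : (K : ℝ) ≤ k := by exact_mod_cast hφ.le_iff_le.1 hn
      linarith [hgφ k]
    · have : (K : ℝ) ≤ n := by exact_mod_cast (hφ.id_le K).trans hn
      simp only [y, if_neg h]
      linarith [hgφ n]
  have hFy := hF y (fun n => by dsimp only [y]; split_ifs <;> exact hx _) hy
  have hFx : Tendsto (fun k => F (φ k) (x (φ k))) atTop atTop := by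
    simpa only [Function.comp_def, hyφ] using hFy.comp hφ.tendsto_atTop
  have huφ : Tendsto (fun k => u (φ k)) atTop atTop :=
    tendsto_atTop_mono' _ (hφ.tendsto_atTop.eventually hle) hFx
  exact not_tendsto_nhds_of_tendsto_atTop huφ l (hu.comp hφ.tendsto_atTop)

/-- Strong stability of minimizers, `T`-`W` version (Theorem 3.4): if `W` satisfies (H1)
and (I3'), `J` is `T`-`W`-sls, `{Jₙ}` is `T`-`W`-coercive and `T`-`W`-uniformly
consistent for `J`, `x̄` is the unique global minimizer of `J` on `D` and each `xₙ` is a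
global minimizer of `Jₙ` on `D`, then `xₙ → x̄` in norm. -/
theorem strong_stability_minimizers_TW
    {X Y : Type*} [NormedAddCommGroup X] [NormedSpace ℝ X]
    [NormedAddCommGroup Y] [NormedSpace ℝ Y]
    (T : X →L[ℝ] Y) (D : Set X) (W : X → ℝ) (J : X → ℝ) (Jn : ℕ → X → ℝ)
    -- (H1)
    (H1 : ∃ γ : ℝ, 0 ≤ γ ∧ ∀ x ∈ D, -γ ≤ W x)
    -- (I3')
    (I3' : ∀ x : ℕ → X, (∀ n, x n ∈ D) → (∃ k : ℝ, ∀ n, |‖T (x n)‖ + W (x n)| ≤ k) →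
      ∃ φ : ℕ → ℕ, StrictMono φ ∧ ∃ x₀ ∈ D, Tendsto (x ∘ φ) atTop (𝓝 x₀))
    -- J is T-W-subsequentially lower semicontinuous
    (hJsls : ∀ x : ℕ → X, (∀ n, x n ∈ D) → (∃ k : ℝ, ∀ n, |‖T (x n)‖ + W (x n)| ≤ k) →
      ∀ x₀ ∈ D, Tendsto x atTop (𝓝 x₀) →
      ∃ φ : ℕ → ℕ, StrictMono φ ∧ J x₀ ≤ liminf (fun j => J (x (φ j))) atTop)
    -- {Jₙ} is T-W-coercive
    (hcoercive : ∀ x : ℕ → X, (∀ n, x n ∈ D) →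
      Tendsto (fun n => ‖T (x n)‖ + W (x n)) atTop atTop →
      Tendsto (fun n => Jn n (x n)) atTop atTop)
    -- {Jₙ} is T-W-uniformly consistent for J
    (hconsist : ∀ c : ℝ, 0 < c → ∀ ε : ℝ, 0 < ε → ∃ N : ℕ, ∀ n ≥ N, ∀ x ∈ D,
      ‖T x‖ + |W x| ≤ c → |Jn n x - J x| < ε)
    -- x̄ is the unique global minimizer of J on D
    (xbar : X) (hxbarD : xbar ∈ D) (hxbarmin : ∀ x ∈ D, J xbar ≤ J x)
    (hxbaruniq : ∀ x' ∈ D, (∀ x ∈ D, J x' ≤ J x) → x' = xbar)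
    -- each xₙ is a global minimizer of Jₙ on D
    (xn : ℕ → X) (hxnD : ∀ n, xn n ∈ D)
    (hxnmin : ∀ n, ∀ x ∈ D, Jn n (xn n) ≤ Jn n x) :
    Tendsto xn atTop (𝓝 xbar) := by
  obtain ⟨γ, hγ, hW⟩ := H1
  have hJn (x : ℕ → X) (hx : ∀ n, x n ∈ D) (k : ℝ) (hk : ∀ n, ‖T (x n)‖ + W (x n) ≤ k) :
      Tendsto (fun n => Jn n (x n) - J (x n)) atTop (𝓝 0) := by
    refine Metric.tendsto_atTop.2 fun ε hε => ?_
    obtain ⟨N, hN⟩ := hconsist (2 * (|k| + γ) + 1) (by positivity) ε hε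
    refine ⟨N, fun n hn => ?_⟩
    rw [Real.dist_0_eq_abs]
    refine hN n hn _ (hx n) ?_
    have h₁ := hW _ (hx n)
    have h₂ := hk n
    have h₃ := norm_nonneg (T (x n))
    have h₄ := le_abs_self k
    have h₅ := abs_nonneg k
    have h₆ : |W (x n)| ≤ |k| + γ := abs_le.2 ⟨by linarith, by linarith⟩
    linarith
  have hbar : Tendsto (fun n => Jn n xbar) atTop (𝓝 (J xbar)) := by
    simpa using (hJn (fun _ => xbar) (fun _ => hxbarD) _ fun _ => le_rfl).add_const (J xbar)
  obtain ⟨k, hk⟩ := bddAbove_range_of_coercive (g := fun x => ‖T x‖ + W x) hcoercive hxnD hbar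
    (Eventually.of_forall fun n => hxnmin n xbar hxbarD)
  have hk (n : ℕ) : ‖T (xn n)‖ + W (xn n) ≤ k := hk ⟨n, rfl⟩
  have hbdd (n : ℕ) : |‖T (xn n)‖ + W (xn n)| ≤ |k| + γ := by
    have h₁ := hW _ (hxnD n)
    have h₂ := hk n
    have h₃ := norm_nonneg (T (xn n))
    have h₄ := le_abs_self k
    have h₅ := abs_nonneg k
    exact abs_le.2 ⟨by linarith, by linarith⟩
  have hJ : Tendsto (fun n => J (xn n)) atTop (𝓝 (J xbar)) := by
    refine tendsto_of_tendsto_of_tendsto_of_le_of_le tendsto_const_nhds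
      (by simpa using hbar.sub (hJn xn hxnD k hk)) (fun n => hxbarmin _ (hxnD n)) fun n => ?_
    have := hxnmin n xbar hxbarD
    simp only
    linarith
  refine tendsto_of_subseq_tendsto fun ns hns => ?_
  obtain ⟨φ, hφ, x₀, hx₀, hlim⟩ := I3' (fun n => xn (ns n)) (fun n => hxnD _) ⟨_, fun n => hbdd _⟩
  obtain ⟨ψ, hψ, hle⟩ := hJsls _ (fun n => hxnD _) ⟨_, fun n => hbdd _⟩ x₀ hx₀ hlim
  have hJlim : Tendsto (fun j => J (xn (ns (φ (ψ j))))) atTop (𝓝 (J xbar)) :=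
    hJ.comp (hns.comp (hφ.tendsto_atTop.comp hψ.tendsto_atTop))
  have hle' : J x₀ ≤ J xbar := hle.trans_eq hJlim.liminf_eq
  obtain rfl := hxbaruniq x₀ hx₀ fun x hx => hle'.trans (hxbarmin x hx)
  exact ⟨φ, hlim⟩
end

section
/- Let X be a real normed vector space, Y a real inner product space, T, T_n : X → Y (n = 1, 2, …) bounded linear operators, y, y_n ∈ Y, α > 0 and α_n > 0, D ⊆ X, and W : D → ℝ a functional satisfying hypotheses (H1), (I2') and (I3'). Define J(x) = ‖Tx − y‖² + α·W(x) and J_n(x) = ‖T_n x − y_n‖² + α_n·W(x) on D. Assume that α_n → α, y_n → y, and {T_n} is W-uniformly consistent for T. Suppose J has a unique global minimizer x̄ ∈ D and for each n, x_n is a global minimizer of J_n on D. Then x_n converges to x̄ in norm. -/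
open Filter Topology

/-- Weak stability for Tikhonov-Phillips type functionals (Corollary 3.4): if `W`
satisfies (H1), (I2'), (I3'), `αₙ → α`, `yₙ → y`, `{Tₙ}` is `W`-uniformly consistent for
`T`, `x̄` is the unique global minimizer of `J(x) = ‖Tx - y‖² + α W x` on `D` and each
`xₙ` is a global minimizer of `Jₙ(x) = ‖Tₙx - yₙ‖² + αₙ W x` on `D`, then `xₙ → x̄` in norm. -/
theorem strong_stability_tikhonov_TW
    {X Y : Type*} [NormedAddCommGroup X] [NormedSpace ℝ X]
    [NormedAddCommGroup Y] [InnerProductSpace ℝ Y]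
    (T : X →L[ℝ] Y) (Tn : ℕ → X →L[ℝ] Y) (y : Y) (yn : ℕ → Y)
    (α : ℝ) (hα : 0 < α) (αn : ℕ → ℝ) (hαn : ∀ n, 0 < αn n)
    (D : Set X) (W : X → ℝ)
    -- (H1)
    (H1 : ∃ γ : ℝ, 0 ≤ γ ∧ ∀ x ∈ D, -γ ≤ W x)
    -- (I2')
    (I2' : ∀ x : ℕ → X, (∀ n, x n ∈ D) → (∃ k : ℝ, ∀ n, |‖T (x n)‖ + W (x n)| ≤ k) →
      ∀ x₀ ∈ D, Tendsto x atTop (𝓝 x₀) →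
      ∃ φ : ℕ → ℕ, StrictMono φ ∧ W x₀ ≤ liminf (fun j => W (x (φ j))) atTop)
    -- (I3')
    (I3' : ∀ x : ℕ → X, (∀ n, x n ∈ D) → (∃ k : ℝ, ∀ n, |‖T (x n)‖ + W (x n)| ≤ k) →
      ∃ φ : ℕ → ℕ, StrictMono φ ∧ ∃ x₀ ∈ D, Tendsto (x ∘ φ) atTop (𝓝 x₀))
    -- parameter and data convergence
    (hαconv : Tendsto αn atTop (𝓝 α)) (hyconv : Tendsto yn atTop (𝓝 y))
    -- {Tₙ} is W-uniformly consistent for T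
    (hTconsist : ∀ c : ℝ, 0 < c → ∀ ε : ℝ, 0 < ε → ∃ N : ℕ, ∀ n ≥ N, ∀ x ∈ D,
      |W x| ≤ c → ‖Tn n x - T x‖ < ε)
    -- x̄ is the unique global minimizer of J on D
    (xbar : X) (hxbarD : xbar ∈ D)
    (hxbarmin : ∀ x ∈ D,
      ‖T xbar - y‖ ^ 2 + α * W xbar ≤ ‖T x - y‖ ^ 2 + α * W x)
    (hxbaruniq : ∀ x' ∈ D,
      (∀ x ∈ D, ‖T x' - y‖ ^ 2 + α * W x' ≤ ‖T x - y‖ ^ 2 + α * W x) → x' = xbar)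
    -- each xₙ is a global minimizer of Jₙ on D
    (xn : ℕ → X) (hxnD : ∀ n, xn n ∈ D)
    (hxnmin : ∀ n, ∀ x ∈ D,
      ‖Tn n (xn n) - yn n‖ ^ 2 + αn n * W (xn n) ≤ ‖Tn n x - yn n‖ ^ 2 + αn n * W x) :
    Tendsto xn atTop (𝓝 xbar) := by
  obtain ⟨γ, hγ, hW⟩ := H1
  have hTx : ∀ x ∈ D, Tendsto (fun n => Tn n x) atTop (𝓝 (T x)) := by
    intro x hx
    rw [Metric.tendsto_atTop]
    intro ε hε
    obtain ⟨N, hN⟩ := hTconsist (|W x| + 1) (by positivity) ε hε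
    exact ⟨N, fun n hn => by rw [dist_eq_norm]; exact hN n hn x hx (by linarith)⟩
  have hJ : ∀ x ∈ D, Tendsto (fun n => ‖Tn n x - yn n‖ ^ 2 + αn n * W x) atTop
      (𝓝 (‖T x - y‖ ^ 2 + α * W x)) := fun x hx =>
    ((((hTx x hx).sub hyconv).norm).pow 2).add (hαconv.mul_const _)
  have hWub : ∃ c, ∀ᶠ n in atTop, W (xn n) ≤ c := by
    refine ⟨(‖T xbar - y‖ ^ 2 + α * W xbar) / α + 1, ?_⟩
    filter_upwards [((hJ xbar hxbarD).div hαconv hα.ne').eventually_lt_const (lt_add_one _)]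
      with n hn
    refine le_trans ?_ hn.le
    rw [Pi.div_apply, le_div_iff₀ (hαn n)]
    nlinarith [hxnmin n xbar hxbarD, sq_nonneg ‖Tn n (xn n) - yn n‖]
  obtain ⟨c, hc⟩ := hWub
  have hWabs : ∀ᶠ n in atTop, |W (xn n)| ≤ |c| + γ + 1 := by
    filter_upwards [hc] with n hn
    rw [abs_le]
    constructor <;> linarith [hW _ (hxnD n), le_abs_self c, abs_nonneg c]
  have hdiff : Tendsto (fun n => Tn n (xn n) - T (xn n)) atTop (𝓝 0) := by
    rw [Metric.tendsto_atTop]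
    intro ε hε
    obtain ⟨N, hN⟩ := hTconsist (|c| + γ + 1) (by positivity) ε hε
    obtain ⟨M, hM⟩ := eventually_atTop.1 hWabs
    refine ⟨max N M, fun n hn => ?_⟩
    rw [dist_zero_right]
    exact hN n (le_of_max_le_left hn) _ (hxnD n) (hM n (le_of_max_le_right hn))
  have hbdd : ∃ k : ℝ, ∀ n, |‖T (xn n)‖ + W (xn n)| ≤ k := by
    obtain ⟨C, hC⟩ : ∃ C, ∀ᶠ n in atTop, ‖Tn n xbar - yn n‖ ^ 2 + αn n * W xbar ≤ C :=
      ⟨_, ((hJ xbar hxbarD).eventually_lt_const (lt_add_one _)).mono fun _ h => h.le⟩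
    have hev : ∀ᶠ n in atTop, |‖T (xn n)‖ + W (xn n)| ≤
        (C + (α + 1) * γ + 1) + (‖y‖ + 1) + 1 + (|c| + γ + 1) := by
      filter_upwards [hC, hWabs, hdiff.norm.eventually_lt_const (by simp : ‖(0 : Y)‖ < 1),
        hyconv.norm.eventually_lt_const (lt_add_one _),
        hαconv.eventually_lt_const (lt_add_one _)] with n h1 h2 h3 h4 h5
      have h6 := hxnmin n xbar hxbarD
      have h7 := hW _ (hxnD n)
      have h8 : -((α + 1) * γ) ≤ αn n * W (xn n) := by nlinarith [hαn n]
      have h9 : ‖Tn n (xn n) - yn n‖ ≤ C + (α + 1) * γ + 1 := by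
        nlinarith [sq_nonneg (‖Tn n (xn n) - yn n‖ - 1), sq_nonneg ‖Tn n (xn n) - yn n‖]
      have h10 : ‖T (xn n)‖ ≤ ‖Tn n (xn n) - yn n‖ + ‖yn n‖ + ‖Tn n (xn n) - T (xn n)‖ := by
        calc ‖T (xn n)‖ = ‖(Tn n (xn n) - yn n) + yn n - (Tn n (xn n) - T (xn n))‖ := by
              congr 1; abel
          _ ≤ _ := (norm_sub_le _ _).trans (by gcongr; exact norm_add_le _ _)
      refine (abs_add_le _ _).trans ?_
      rw [abs_norm]
      linarith
    obtain ⟨k, hk⟩ := (isBoundedUnder_of_eventually_le hev).bddAbove_range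
    exact ⟨k, fun n => hk ⟨n, rfl⟩⟩
  obtain ⟨k, hk⟩ := hbdd
  refine tendsto_of_subseq_tendsto fun ns hns => ?_
  obtain ⟨φ, hφ, x₀, hx₀, hlim⟩ := I3' (xn ∘ ns) (fun n => hxnD _) ⟨k, fun n => hk _⟩
  refine ⟨φ, ?_⟩
  obtain ⟨ψ, hψ, hle⟩ := I2' (xn ∘ ns ∘ φ) (fun n => hxnD _) ⟨k, fun n => hk _⟩ x₀ hx₀ hlim
  suffices x₀ = xbar from this ▸ hlim
  refine hxbaruniq x₀ hx₀ fun x hx => ?_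
  have hm : Tendsto (fun j => ns (φ (ψ j))) atTop atTop :=
    hns.comp (hφ.tendsto_atTop.comp hψ.tendsto_atTop)
  have hTu : Tendsto (fun j => Tn (ns (φ (ψ j))) (xn (ns (φ (ψ j))))) atTop (𝓝 (T x₀)) := by
    have h := (hdiff.comp hm).add ((T.continuous.tendsto x₀).comp (hlim.comp hψ.tendsto_atTop))
    simpa [Function.comp_def] using h
  have hupper := (((hJ x hx).comp hm).sub
    (((hTu.sub (hyconv.comp hm)).norm).pow 2)).div (hαconv.comp hm) hα.ne'
  have hlimle : liminf (fun j => W (xn (ns (φ (ψ j))))) atTop ≤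
      (‖T x - y‖ ^ 2 + α * W x - ‖T x₀ - y‖ ^ 2) / α := by
    rw [← hupper.liminf_eq]
    refine liminf_le_liminf (Eventually.of_forall fun j => ?_)
      (isBoundedUnder_of ⟨-γ, fun j => hW _ (hxnD _)⟩) hupper.isCoboundedUnder_ge
    simp only [Pi.div_apply, Function.comp_apply]
    rw [le_div_iff₀ (hαn _)]
    linarith [hxnmin (ns (φ (ψ j))) x hx]
  have h := (le_div_iff₀ hα).1 (hle.trans hlimle)
  linarith
end

section
/- Let X and Z be real Hilbert spaces, Y a real inner product space, T : X → Y a bounded linear operator, and L : D(L) ⊆ X → Z a closed linear operator whose range R(L) is a closed subspace of Z. Assume that T and L are complemented, i.e. there exists a constant k > 0 such that ‖Tx‖² + ‖Lx‖² ≥ k‖x‖² for all x ∈ D(L). Then for every q > 1, α > 0 and y ∈ Y, the functional J_{L,q,α}(x) = ‖Tx − y‖² + α‖Lx‖^q has a unique global minimizer on D(L). -/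
open Filter Topology

theorem norm_sub_sq_eq_midpoint {E : Type*} [NormedAddCommGroup E] [InnerProductSpace ℝ E]
    (u v : E) :
    ‖u - v‖ ^ 2 = 2 * ‖u‖ ^ 2 + 2 * ‖v‖ ^ 2 - 4 * ‖(1 / 2 : ℝ) • (u + v)‖ ^ 2 := by
  have h := parallelogram_law_with_norm ℝ u v
  rw [norm_smul, Real.norm_of_nonneg (by norm_num)]
  nlinarith

theorem norm_midpoint_rpow_le {E : Type*} [NormedAddCommGroup E] [NormedSpace ℝ E]
    {q : ℝ} (hq : 1 ≤ q) (u v : E) :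
    ‖(1 / 2 : ℝ) • (u + v)‖ ^ q ≤ (‖u‖ ^ q + ‖v‖ ^ q) / 2 := by
  have hconv := (convexOn_rpow hq).2 (norm_nonneg u) (norm_nonneg v)
    (by norm_num : (0 : ℝ) ≤ 1 / 2) (by norm_num : (0 : ℝ) ≤ 1 / 2) (by norm_num)
  simp only [smul_eq_mul] at hconv
  have hnorm : ‖(1 / 2 : ℝ) • (u + v)‖ ≤ 1 / 2 * ‖u‖ + 1 / 2 * ‖v‖ := by
    rw [norm_smul, Real.norm_of_nonneg (by norm_num)]
    linarith [norm_add_le u v]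
  linarith [Real.rpow_le_rpow (norm_nonneg _) hnorm (by linarith : 0 ≤ q)]

/-- If the `q`-th power of the norm of a midpoint is bounded below by `G`, then the distance of the
two endpoints is bounded above. -/
theorem norm_sub_sq_le_of_le_midpoint_rpow {E : Type*} [NormedAddCommGroup E]
    [InnerProductSpace ℝ E] {q G : ℝ} (hq : 0 < q) {u v : E}
    (hG : G ≤ ‖(1 / 2 : ℝ) • (u + v)‖ ^ q) :
    ‖u - v‖ ^ 2 ≤ 2 * ‖u‖ ^ 2 + 2 * ‖v‖ ^ 2 - 4 * (max G 0) ^ (2 / q) := by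
  have hmax : max G 0 ≤ ‖(1 / 2 : ℝ) • (u + v)‖ ^ q := max_le hG (by positivity)
  have hpow := Real.rpow_le_rpow (le_max_right G 0) hmax (by positivity : 0 ≤ 2 / q)
  rw [← Real.rpow_mul (norm_nonneg _), mul_div_cancel₀ _ hq.ne', Real.rpow_two] at hpow
  linarith [norm_sub_sq_eq_midpoint u v]

section Penalizer

variable {X Z Y : Type*}
  [NormedAddCommGroup X] [InnerProductSpace ℝ X]
  [NormedAddCommGroup Z] [InnerProductSpace ℝ Z]
  [NormedAddCommGroup Y] [InnerProductSpace ℝ Y]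

/-- The penalized least-squares functional `x ↦ ‖Tx - y‖² + α ‖Lx‖^q` on the domain of `L`. -/
noncomputable def penalizedFunctional (T : X →L[ℝ] Y) (L : X →ₗ.[ℝ] Z) (q α : ℝ) (y : Y)
    (x : L.domain) : ℝ :=
  ‖T (x : X) - y‖ ^ 2 + α * ‖L x‖ ^ q

variable {T : X →L[ℝ] Y} {L : X →ₗ.[ℝ] Z} {q α : ℝ} {y : Y}

theorem penalizedFunctional_nonneg (hα : 0 ≤ α) (x : L.domain) :
    0 ≤ penalizedFunctional T L q α y x := by
  unfold penalizedFunctional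
  positivity

theorem penalizedFunctional_midpoint (a b : L.domain) :
    ‖T (a : X) - T (b : X)‖ ^ 2 / 4
        + α * ((‖L a‖ ^ q + ‖L b‖ ^ q) / 2 - ‖(1 / 2 : ℝ) • (L a + L b)‖ ^ q) =
      (penalizedFunctional T L q α y a + penalizedFunctional T L q α y b) / 2
        - penalizedFunctional T L q α y ((1 / 2 : ℝ) • (a + b)) := by
  have h := norm_sub_sq_eq_midpoint (T (a : X) - y) (T (b : X) - y)
  have hmid : (1 / 2 : ℝ) • (T (a : X) - y + (T (b : X) - y)) =
      T (((1 / 2 : ℝ) • (a + b) : L.domain) : X) - y := by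
    simp only [Submodule.coe_smul, Submodule.coe_add, map_smul, map_add]
    module
  rw [hmid, sub_sub_sub_cancel_right] at h
  simp only [penalizedFunctional, LinearPMap.map_smul, LinearPMap.map_add]
  linarith

theorem norm_map_sub_sq_le (hq : 1 ≤ q) (hα : 0 ≤ α) {c : ℝ}
    (hc : ∀ x, c ≤ penalizedFunctional T L q α y x) (a b : L.domain) :
    ‖T (a : X) - T (b : X)‖ ^ 2 ≤
      4 * ((penalizedFunctional T L q α y a + penalizedFunctional T L q α y b) / 2 - c) := by
  have h := penalizedFunctional_midpoint (T := T) (q := q) (α := α) (y := y) a b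
  have := mul_nonneg hα (sub_nonneg.2 (norm_midpoint_rpow_le hq (L a) (L b)))
  linarith [hc ((1 / 2 : ℝ) • (a + b))]

theorem norm_penalizer_sub_sq_le (hq : 0 < q) (hα : 0 < α) {c : ℝ}
    (hc : ∀ x, c ≤ penalizedFunctional T L q α y x) (a b : L.domain) :
    ‖L a - L b‖ ^ 2 ≤ 2 * ‖L a‖ ^ 2 + 2 * ‖L b‖ ^ 2
      - 4 * (max ((‖L a‖ ^ q + ‖L b‖ ^ q) / 2 - ((penalizedFunctional T L q α y a
        + penalizedFunctional T L q α y b) / 2 - c) / α) 0) ^ (2 / q) := by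
  refine norm_sub_sq_le_of_le_midpoint_rpow hq ?_
  have h := penalizedFunctional_midpoint (T := T) (q := q) (α := α) (y := y) a b
  rw [sub_le_comm, le_div_iff₀ hα]
  nlinarith [hc ((1 / 2 : ℝ) • (a + b)), sq_nonneg ‖T (a : X) - T (b : X)‖]

theorem cauchySeq_of_tendsto_norm_sub_sq {E : Type*} [NormedAddCommGroup E] {u : ℕ → E}
    {B : ℕ × ℕ → ℝ} (hB : Tendsto B atTop (𝓝 0))
    (h : ∀ p : ℕ × ℕ, ‖u p.1 - u p.2‖ ^ 2 ≤ B p) : CauchySeq u := by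
  rw [cauchySeq_iff_tendsto_dist_atTop_0]
  have hsq : Tendsto (fun p : ℕ × ℕ => ‖u p.1 - u p.2‖ ^ 2) atTop (𝓝 0) :=
    squeeze_zero (fun _ => sq_nonneg _) h hB
  simpa [dist_eq_norm, Real.sqrt_sq] using hsq.sqrt

theorem rpow_rpow_two_div (hq : 0 < q) {r : ℝ} (hr : 0 ≤ r) :
    (max (r ^ q) 0) ^ (2 / q) = r ^ 2 := by
  rw [max_eq_left (by positivity), ← Real.rpow_mul hr, mul_div_cancel₀ _ hq.ne', Real.rpow_two]

/-- Every sequence along which the functional tends to a lower bound and `‖L u‖` converges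
is Cauchy after applying `T` and after applying `L`. -/
theorem cauchySeq_of_tendsto_penalizedFunctional (hq : 1 ≤ q) (hα : 0 < α) {c r : ℝ}
    (hc : ∀ x, c ≤ penalizedFunctional T L q α y x) {u : ℕ → L.domain}
    (hJ : Tendsto (fun n => penalizedFunctional T L q α y (u n)) atTop (𝓝 c))
    (hr : Tendsto (fun n => ‖L (u n)‖) atTop (𝓝 r)) :
    CauchySeq (fun n => T (u n : X)) ∧ CauchySeq (fun n => L (u n)) := by
  have hq0 : 0 < q := by linarith
  have hr0 : 0 ≤ r := ge_of_tendsto' hr fun _ => norm_nonneg _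
  have hfst : Tendsto (Prod.fst : ℕ × ℕ → ℕ) atTop atTop := by
    rw [← prod_atTop_atTop_eq]; exact tendsto_fst
  have hsnd : Tendsto (Prod.snd : ℕ × ℕ → ℕ) atTop atTop := by
    rw [← prod_atTop_atTop_eq]; exact tendsto_snd
  have hgap := (((hJ.comp hfst).add (hJ.comp hsnd)).div_const 2).sub_const c
  have hpow := hr.rpow_const (p := q) (Or.inr hq0.le)
  constructor
  · refine cauchySeq_of_tendsto_norm_sub_sq ?_ fun p =>
      norm_map_sub_sq_le hq hα.le hc (u p.1) (u p.2)
    have := hgap.const_mul 4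
    rwa [add_self_div_two, sub_self, mul_zero] at this
  · refine cauchySeq_of_tendsto_norm_sub_sq ?_ fun p =>
      norm_penalizer_sub_sq_le hq0 hα hc (u p.1) (u p.2)
    have hG := (((hpow.comp hfst).add (hpow.comp hsnd)).div_const 2).sub (hgap.div_const α)
    have hroot := (hG.max (tendsto_const_nhds (x := (0 : ℝ)))).rpow_const (p := 2 / q)
      (Or.inr (by positivity))
    have := ((((hr.comp hfst).pow 2).const_mul 2).add (((hr.comp hsnd).pow 2).const_mul 2)).sub
      (hroot.const_mul 4)
    rw [add_self_div_two, add_self_div_two, sub_self, zero_div, sub_zero,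
      rpow_rpow_two_div hq0 hr0, show 2 * r ^ 2 + 2 * r ^ 2 - 4 * r ^ 2 = 0 by ring] at this
    exact this

theorem exists_minimizing_seq (hq : 0 < q) (hα : 0 < α) :
    ∃ (c r : ℝ) (u : ℕ → L.domain), (∀ x, c ≤ penalizedFunctional T L q α y x) ∧
      Tendsto (fun n => penalizedFunctional T L q α y (u n)) atTop (𝓝 c) ∧
      Tendsto (fun n => ‖L (u n)‖) atTop (𝓝 r) := by
  have hbdd : BddBelow (Set.range (penalizedFunctional T L q α y)) :=
    ⟨0, Set.forall_mem_range.2 (penalizedFunctional_nonneg hα.le)⟩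
  obtain ⟨v, -, hv, hvmem⟩ := exists_seq_tendsto_sInf (Set.range_nonempty _) hbdd
  choose u hu using hvmem
  obtain ⟨B, hB⟩ := hv.bddAbove_range
  have hmem : ∀ n, ‖L (u n)‖ ∈ Set.Icc 0 ((B / α) ^ q⁻¹) := fun n => by
    have hle : penalizedFunctional T L q α y (u n) ≤ B := (hu n).trans_le (hB ⟨n, rfl⟩)
    have hpow : ‖L (u n)‖ ^ q ≤ B / α := by
      rw [le_div_iff₀ hα]
      unfold penalizedFunctional at hle
      linarith [sq_nonneg ‖T (u n : X) - y‖]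
    have := Real.rpow_le_rpow (by positivity) hpow (inv_nonneg.2 hq.le)
    rw [Real.rpow_rpow_inv (norm_nonneg _) hq.ne'] at this
    exact ⟨norm_nonneg _, this⟩
  obtain ⟨r, -, φ, hφ, hr⟩ := isCompact_Icc.tendsto_subseq hmem
  refine ⟨_, r, u ∘ φ, fun x => csInf_le hbdd ⟨x, rfl⟩, ?_, hr⟩
  simpa only [Function.comp_def, hu] using hv.comp hφ.tendsto_atTop

theorem exists_penalizedFunctional_minimizer [CompleteSpace X] [CompleteSpace Z]
    (hL : L.IsClosed) {k : ℝ} (hk : 0 < k)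
    (hcompl : ∀ x : L.domain, k * ‖(x : X)‖ ^ 2 ≤ ‖T (x : X)‖ ^ 2 + ‖L x‖ ^ 2)
    (hq : 1 ≤ q) (hα : 0 < α) :
    ∃ a : L.domain, ∀ x, penalizedFunctional T L q α y a ≤ penalizedFunctional T L q α y x := by
  obtain ⟨c, r, u, hc, hJ, hr⟩ := exists_minimizing_seq (T := T) (L := L) (y := y)
    (by linarith : 0 < q) hα
  obtain ⟨hT, hLu⟩ := cauchySeq_of_tendsto_penalizedFunctional hq hα hc hJ hr
  have hu : CauchySeq (fun n => (u n : X)) := by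
    have hTd := (cauchySeq_iff_tendsto_dist_atTop_0.1 hT).pow 2
    have hLd := (cauchySeq_iff_tendsto_dist_atTop_0.1 hLu).pow 2
    have hB := (hTd.add hLd).div_const k
    norm_num at hB
    refine cauchySeq_of_tendsto_norm_sub_sq hB fun p => ?_
    have h := hcompl (u p.1 - u p.2)
    rw [L.map_sub, Submodule.coe_sub, map_sub] at h
    rw [le_div_iff₀ hk, dist_eq_norm, dist_eq_norm]
    linarith
  obtain ⟨x, hx⟩ := cauchySeq_tendsto_of_complete hu
  obtain ⟨z, hz⟩ := cauchySeq_tendsto_of_complete hLu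
  have hgraph : (x, z) ∈ (L.graph : Set (X × Z)) :=
    IsClosed.mem_of_tendsto hL (hx.prodMk_nhds hz) (Eventually.of_forall fun n => L.mem_graph (u n))
  obtain ⟨a, rfl, rfl⟩ := (L.mem_graph_iff).1 hgraph
  have hlim : Tendsto (fun n => penalizedFunctional T L q α y (u n)) atTop
      (𝓝 (penalizedFunctional T L q α y a)) :=
    ((((T.continuous.tendsto _).comp hx).sub_const y).norm.pow 2).add
      ((hz.norm.rpow_const (Or.inr (by linarith))).const_mul α)
  exact ⟨a, fun b => (tendsto_nhds_unique hlim hJ).trans_le (hc b)⟩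

theorem penalizedFunctional_minimizer_unique {k : ℝ} (hk : 0 < k)
    (hcompl : ∀ x : L.domain, k * ‖(x : X)‖ ^ 2 ≤ ‖T (x : X)‖ ^ 2 + ‖L x‖ ^ 2)
    (hq : 1 ≤ q) (hα : 0 < α) {a b : L.domain}
    (ha : ∀ x, penalizedFunctional T L q α y a ≤ penalizedFunctional T L q α y x)
    (hb : ∀ x, penalizedFunctional T L q α y b ≤ penalizedFunctional T L q α y x) : a = b := by
  have hq0 : 0 < q := by linarith
  have hJ := le_antisymm (ha b) (hb a)
  have hTab := norm_map_sub_sq_le hq hα.le ha a b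
  rw [← hJ, add_self_div_two, sub_self, mul_zero] at hTab
  have hT : T (a : X) = T (b : X) := by
    rw [← sub_eq_zero, ← norm_eq_zero]
    exact pow_eq_zero_iff two_ne_zero |>.1 (le_antisymm hTab (sq_nonneg _))
  have hnorm : ‖L a‖ = ‖L b‖ := by
    have hpow : ‖L a‖ ^ q = ‖L b‖ ^ q := by
      simpa [penalizedFunctional, hT, hα.ne'] using hJ
    exact (Real.rpow_left_inj (norm_nonneg _) (norm_nonneg _) hq0.ne').1 hpow
  have hLab := norm_penalizer_sub_sq_le hq0 hα ha a b
  rw [← hJ, ← hnorm, add_self_div_two, add_self_div_two, sub_self, zero_div, sub_zero,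
    rpow_rpow_two_div hq0 (norm_nonneg _)] at hLab
  have h := hcompl (a - b)
  rw [L.map_sub, Submodule.coe_sub, map_sub] at h
  have hzero : ‖(a : X) - b‖ ^ 2 = 0 := by
    nlinarith [sq_nonneg ‖(a : X) - b‖]
  exact Subtype.ext (sub_eq_zero.1 (norm_eq_zero.1 (pow_eq_zero_iff two_ne_zero |>.1 hzero)))

end Penalizer

/-- Existence and uniqueness of the global minimizer of
`J_{L,q,α}(x) = ‖Tx - y‖² + α ‖Lx‖^q` on the domain of a closed, closed-range linear
operator `L`, when `T` and `L` are complemented (Theorem 4.1). -/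
theorem existence_uniqueness_closed_operator_penalizer
    {X Z Y : Type*}
    [NormedAddCommGroup X] [InnerProductSpace ℝ X] [CompleteSpace X]
    [NormedAddCommGroup Z] [InnerProductSpace ℝ Z] [CompleteSpace Z]
    [NormedAddCommGroup Y] [InnerProductSpace ℝ Y]
    (T : X →L[ℝ] Y) (L : X →ₗ.[ℝ] Z)
    (hLclosed : L.IsClosed)
    (hLrange : IsClosed (LinearMap.range L.toFun : Set Z))
    (k : ℝ) (hk : 0 < k)
    (hcompl : ∀ x : L.domain, k * ‖(x : X)‖ ^ 2 ≤ ‖T (x : X)‖ ^ 2 + ‖L x‖ ^ 2)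
    (q : ℝ) (hq : 1 < q) (α : ℝ) (hα : 0 < α) (y : Y) :
    ∃! xbar : L.domain, ∀ x : L.domain,
      ‖T (xbar : X) - y‖ ^ 2 + α * ‖L xbar‖ ^ q ≤ ‖T (x : X) - y‖ ^ 2 + α * ‖L x‖ ^ q := by
  obtain ⟨a, ha⟩ := exists_penalizedFunctional_minimizer (T := T) (y := y)
    hLclosed hk hcompl hq.le hα
  exact ⟨a, ha, fun b hb => penalizedFunctional_minimizer_unique hk hcompl hq.le hα hb ha⟩
end

section
/- Let X and Z be real Hilbert spaces, Y a real Hilbert space, T : X → Y a bounded linear operator, L : D(L) ⊆ X → Z a closed linear operator with closed range, and assume there exists k > 0 with ‖Tx‖² + ‖Lx‖² ≥ k‖x‖² for all x ∈ D(L). Let y, y_n ∈ Y, α > 0, α_n > 0, with α_n → α and y_n → y as n → ∞. Let x̄ be the unique global minimizer on D(L) of J(x) = ‖Tx − y‖² + α‖Lx‖², and for each n let x_n be the unique global minimizer on D(L) of J_n(x) = ‖Tx − y_n‖² + α_n‖Lx‖². Then x_n converges to x̄ in norm (no compactness assumption is required in the quadratic case q = 2). -/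
open Filter Topology

open scoped RealInnerProductSpace in
/-- The Euler equation satisfied by a minimizer of a quadratic Tikhonov functional. -/
theorem inner_add_mul_inner_eq_zero_of_isMinimizer
    {X Z Y : Type*}
    [NormedAddCommGroup X] [InnerProductSpace ℝ X]
    [NormedAddCommGroup Z] [InnerProductSpace ℝ Z]
    [NormedAddCommGroup Y] [InnerProductSpace ℝ Y]
    (T : X →L[ℝ] Y) (L : X →ₗ.[ℝ] Z) (y : Y) (a : ℝ) (u : L.domain)
    (hu : ∀ x : L.domain,
      ‖T (u : X) - y‖ ^ 2 + a * ‖L u‖ ^ 2 ≤ ‖T (x : X) - y‖ ^ 2 + a * ‖L x‖ ^ 2)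
    (h : L.domain) :
    ⟪T (u : X) - y, T (h : X)⟫ + a * ⟪L u, L h⟫ = 0 := by
  have key : ∀ t : ℝ, 0 ≤ (‖T (h : X)‖ ^ 2 + a * ‖L h‖ ^ 2) * (t * t) +
      (2 * (⟪T (u : X) - y, T (h : X)⟫ + a * ⟪L u, L h⟫)) * t + 0 := by
    intro t
    have hmin := hu (u + t • h)
    have hT : T ((u + t • h : L.domain) : X) - y = (T (u : X) - y) + t • T (h : X) := by
      simp only [Submodule.coe_add, Submodule.coe_smul, map_add, map_smul]
      abel
    rw [hT, LinearPMap.map_add, LinearPMap.map_smul, norm_add_sq_real, norm_add_sq_real,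
      norm_smul, norm_smul, inner_smul_right, inner_smul_right, mul_pow, mul_pow,
      Real.norm_eq_abs, sq_abs] at hmin
    linarith
  have hdisc := discrim_le_zero key
  rw [discrim] at hdisc
  nlinarith

open scoped RealInnerProductSpace in
/-- Stability estimate for minimizers of quadratic Tikhonov functionals under perturbation of the
data and of the regularization parameter. -/
theorem norm_sq_sub_le_of_isMinimizer
    {X Z Y : Type*}
    [NormedAddCommGroup X] [InnerProductSpace ℝ X]
    [NormedAddCommGroup Z] [InnerProductSpace ℝ Z]
    [NormedAddCommGroup Y] [InnerProductSpace ℝ Y]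
    (T : X →L[ℝ] Y) (L : X →ₗ.[ℝ] Z) (y z : Y) (a b : ℝ) (hb : 0 < b) (u v : L.domain)
    (hu : ∀ x : L.domain,
      ‖T (u : X) - y‖ ^ 2 + a * ‖L u‖ ^ 2 ≤ ‖T (x : X) - y‖ ^ 2 + a * ‖L x‖ ^ 2)
    (hv : ∀ x : L.domain,
      ‖T (v : X) - z‖ ^ 2 + b * ‖L v‖ ^ 2 ≤ ‖T (x : X) - z‖ ^ 2 + b * ‖L x‖ ^ 2) :
    ‖T ((v - u : L.domain) : X)‖ ^ 2 + b * ‖L (v - u)‖ ^ 2 ≤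
      ‖z - y‖ ^ 2 + (b - a) ^ 2 * ‖L u‖ ^ 2 / b := by
  have eu := inner_add_mul_inner_eq_zero_of_isMinimizer T L y a u hu (v - u)
  have ev := inner_add_mul_inner_eq_zero_of_isMinimizer T L z b v hv (v - u)
  set d := v - u with hd
  have hv' : v = u + d := by rw [hd]; abel
  have hT : T (v : X) - z = (T (u : X) - y) + T (d : X) - (z - y) := by
    rw [hv', Submodule.coe_add, map_add]
    abel
  rw [hT, hv', LinearPMap.map_add, inner_sub_left, inner_add_left, inner_add_left,
    real_inner_self_eq_norm_sq, real_inner_self_eq_norm_sq] at ev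
  have hY : 0 ≤ ‖(z - y) - T (d : X)‖ ^ 2 := sq_nonneg _
  have hZ : 0 ≤ ‖(b - a) • L u + b • L d‖ ^ 2 / b := by positivity
  rw [norm_sub_sq_real] at hY
  rw [norm_add_sq_real, norm_smul, norm_smul, inner_smul_left, inner_smul_right, mul_pow, mul_pow,
    Real.norm_eq_abs, Real.norm_eq_abs, sq_abs, sq_abs, conj_trivial] at hZ
  have hexp : ((b - a) ^ 2 * ‖L u‖ ^ 2 + 2 * ((b - a) * (b * ⟪L u, L d⟫)) + b ^ 2 * ‖L d‖ ^ 2) / b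
      = (b - a) ^ 2 * ‖L u‖ ^ 2 / b + 2 * ((b - a) * ⟪L u, L d⟫) + b * ‖L d‖ ^ 2 := by
    field_simp
  rw [hexp] at hZ
  linarith

/-- Strong continuity with respect to data and parameter in the quadratic case `q = 2`
(Remark 4.1): if `αₙ → α` and `yₙ → y`, the unique minimizers of
`Jₙ(x) = ‖Tx - yₙ‖² + αₙ ‖Lx‖²` converge in norm to the unique minimizer of
`J(x) = ‖Tx - y‖² + α ‖Lx‖²`; no compactness assumption is required. -/
theorem strong_stability_closed_operator_penalizer_quadratic
    {X Z Y : Type*}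
    [NormedAddCommGroup X] [InnerProductSpace ℝ X] [CompleteSpace X]
    [NormedAddCommGroup Z] [InnerProductSpace ℝ Z] [CompleteSpace Z]
    [NormedAddCommGroup Y] [InnerProductSpace ℝ Y] [CompleteSpace Y]
    (T : X →L[ℝ] Y) (L : X →ₗ.[ℝ] Z)
    (hLclosed : L.IsClosed)
    (hLrange : IsClosed (LinearMap.range L.toFun : Set Z))
    (k : ℝ) (hk : 0 < k)
    (hcompl : ∀ x : L.domain, k * ‖(x : X)‖ ^ 2 ≤ ‖T (x : X)‖ ^ 2 + ‖L x‖ ^ 2)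
    (y : Y) (yn : ℕ → Y) (α : ℝ) (hα : 0 < α) (αn : ℕ → ℝ) (hαn : ∀ n, 0 < αn n)
    (hαconv : Tendsto αn atTop (𝓝 α)) (hyconv : Tendsto yn atTop (𝓝 y))
    -- x̄ is the unique global minimizer of J on D(L)
    (xbar : L.domain)
    (hxbarmin : ∀ x : L.domain,
      ‖T (xbar : X) - y‖ ^ 2 + α * ‖L xbar‖ ^ 2 ≤ ‖T (x : X) - y‖ ^ 2 + α * ‖L x‖ ^ 2)
    (hxbaruniq : ∀ x' : L.domain,
      (∀ x : L.domain,
        ‖T (x' : X) - y‖ ^ 2 + α * ‖L x'‖ ^ 2 ≤ ‖T (x : X) - y‖ ^ 2 + α * ‖L x‖ ^ 2) →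
      x' = xbar)
    -- xₙ is the unique global minimizer of Jₙ on D(L)
    (xn : ℕ → L.domain)
    (hxnmin : ∀ n, ∀ x : L.domain,
      ‖T (xn n : X) - yn n‖ ^ 2 + αn n * ‖L (xn n)‖ ^ 2 ≤
        ‖T (x : X) - yn n‖ ^ 2 + αn n * ‖L x‖ ^ 2)
    (hxnuniq : ∀ n, ∀ x' : L.domain,
      (∀ x : L.domain,
        ‖T (x' : X) - yn n‖ ^ 2 + αn n * ‖L x'‖ ^ 2 ≤
          ‖T (x : X) - yn n‖ ^ 2 + αn n * ‖L x‖ ^ 2) →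
      x' = xn n) :
    Tendsto (fun n => (xn n : X)) atTop (𝓝 (xbar : X)) := by
  set e : ℕ → ℝ := fun n => ‖yn n - y‖ ^ 2 + (αn n - α) ^ 2 * ‖L xbar‖ ^ 2 / αn n
  have hbound : ∀ n, ‖(xn n : X) - xbar‖ ^ 2 ≤ (1 + (αn n)⁻¹) * e n / k := by
    intro n
    have hest : _ ≤ e n :=
      norm_sq_sub_le_of_isMinimizer T L y (yn n) α (αn n) (hαn n) xbar (xn n) hxbarmin (hxnmin n)
    have hc := hcompl (xn n - xbar)
    have hpos := hαn n
    rw [← Submodule.coe_sub, le_div_iff₀ hk, mul_comm]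
    have hL : ‖L (xn n - xbar)‖ ^ 2 ≤ (αn n)⁻¹ * e n := by
      rw [inv_mul_eq_div, le_div_iff₀ hpos]
      nlinarith [sq_nonneg ‖T ((xn n - xbar : L.domain) : X)‖]
    nlinarith [mul_nonneg hpos.le (sq_nonneg ‖L (xn n - xbar)‖)]
  have hlim : Tendsto (fun n => (1 + (αn n)⁻¹) * e n / k) atTop (𝓝 0) := by
    have hy : Tendsto (fun n => ‖yn n - y‖ ^ 2) atTop (𝓝 (‖y - y‖ ^ 2)) :=
      (hyconv.sub_const y).norm.pow 2
    have ha : Tendsto (fun n => (αn n - α) ^ 2 * ‖L xbar‖ ^ 2 / αn n) atTop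
        (𝓝 ((α - α) ^ 2 * ‖L xbar‖ ^ 2 / α)) :=
      (((hαconv.sub_const α).pow 2).mul_const _).div hαconv hα.ne'
    simpa using (((hαconv.inv₀ hα.ne').const_add 1).mul (hy.add ha)).div_const k
  have hsq := squeeze_zero (fun n => sq_nonneg ‖(xn n : X) - xbar‖) hbound hlim
  rw [tendsto_iff_norm_sub_tendsto_zero]
  simpa using hsq.sqrt
end

section
/- Let N ≥ 1 be an integer, X and Z_1, …, Z_N real Hilbert spaces, Y a real inner product space, T, T_n : X → Y (n = 1, 2, …) bounded linear operators, D a linear subspace of X, and L_i : D → Z_i (i = 1, …, N) closed linear operators with closed ranges such that ‖Tx‖² + Σ_{i=1}^N ‖L_i x‖² ≥ k‖x‖² for all x ∈ D and some k > 0. Fix q_i > 1 and α_i > 0 for i = 1, …, N, and let y, y_n ∈ Y with y_n → y, let α_i^n > 0 with α_i^n → α_i as n → ∞ for each i, and assume T_n x → T x uniformly on subsets of D on which all ‖L_i x‖ are bounded. Let x̄ be the unique global minimizer on D of J(x) = ‖Tx − y‖² + Σ_{i=1}^N α_i ‖L_i x‖^{q_i}, and for each n let x_n be a global minimizer on D of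 J_n(x) = ‖T_n x − y_n‖² + Σ_{i=1}^N α_i^n ‖L_i x‖^{q_i}. Then x_n converges weakly to x̄. -/
open Filter Topology

/-- The midpoint convexity defect of `‖·‖ ^ p` at `a`, `b`. -/
noncomputable def midpointDefect {E : Type*} [SeminormedAddCommGroup E] [NormedSpace ℝ E]
    (p : ℝ) (a b : E) : ℝ :=
  (‖a‖ ^ p + ‖b‖ ^ p) / 2 - ‖(2⁻¹ : ℝ) • (a + b)‖ ^ p

lemma norm_half_smul_add_le {E : Type*} [SeminormedAddCommGroup E] [NormedSpace ℝ E] (a b : E) :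
    ‖(2⁻¹ : ℝ) • (a + b)‖ ≤ (‖a‖ + ‖b‖) / 2 := by
  rw [norm_smul, Real.norm_of_nonneg (by norm_num)]
  linarith [norm_add_le a b]

lemma rpow_half_add_le {p u v : ℝ} (hp : 1 < p) (hu : 0 ≤ u) (hv : 0 ≤ v) :
    ((u + v) / 2) ^ p ≤ (u ^ p + v ^ p) / 2 := by
  have h := (convexOn_rpow hp.le).2 (Set.mem_Ici.2 hu) (Set.mem_Ici.2 hv)
    (by norm_num : (0 : ℝ) ≤ 1 / 2) (by norm_num : (0 : ℝ) ≤ 1 / 2) (by norm_num)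
  simp only [smul_eq_mul] at h
  rw [show (u + v) / 2 = 1 / 2 * u + 1 / 2 * v by ring]
  linarith

lemma rpow_half_add_lt {p u v : ℝ} (hp : 1 < p) (hu : 0 ≤ u) (hv : 0 ≤ v) (huv : u ≠ v) :
    ((u + v) / 2) ^ p < (u ^ p + v ^ p) / 2 := by
  have h := (strictConvexOn_rpow hp).2 (Set.mem_Ici.2 hu) (Set.mem_Ici.2 hv) huv
    (by norm_num : (0 : ℝ) < 1 / 2) (by norm_num : (0 : ℝ) < 1 / 2) (by norm_num)
  simp only [smul_eq_mul] at h
  rw [show (u + v) / 2 = 1 / 2 * u + 1 / 2 * v by ring]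
  linarith

lemma midpointDefect_nonneg {E : Type*} [SeminormedAddCommGroup E] [NormedSpace ℝ E]
    {p : ℝ} (hp : 1 < p) (a b : E) : 0 ≤ midpointDefect p a b := by
  have h1 := Real.rpow_le_rpow (norm_nonneg _) (norm_half_smul_add_le a b) (by linarith : 0 ≤ p)
  have h2 := rpow_half_add_le hp (norm_nonneg a) (norm_nonneg b)
  unfold midpointDefect
  linarith

lemma tendsto_of_rpow_defect_tendsto_zero {ι : Type*} {l : Filter ι} {p : ℝ} (hp : 1 < p)
    {u : ι → ℝ} {v c : ℝ} (hu : ∀ n, 0 ≤ u n) (hv : 0 ≤ v) (hc : ∀ᶠ n in l, u n ≤ c)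
    (h : Tendsto (fun n => (u n ^ p + v ^ p) / 2 - ((u n + v) / 2) ^ p) l (𝓝 0)) :
    Tendsto u l (𝓝 v) := by
  refine (isCompact_Icc (a := (0 : ℝ)) (b := c)).tendsto_nhds_of_unique_mapClusterPt
    (hc.mono fun n hn => ⟨hu n, hn⟩) ?_
  intro w hw hcl
  by_contra hne
  have hcont : Continuous fun t : ℝ => (t ^ p + v ^ p) / 2 - ((t + v) / 2) ^ p := by
    have := Real.continuous_rpow_const (q := p) (by linarith)
    fun_prop
  have h1 := hcl.continuousAt_comp hcont.continuousAt
  have h2 : (w ^ p + v ^ p) / 2 - ((w + v) / 2) ^ p = 0 :=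
    eq_of_nhds_neBot (NeBot.mono h1 (inf_le_inf_left _ h))
  linarith [rpow_half_add_lt hp hw.1 hv hne]

/-- Local uniform convexity of `‖·‖ ^ p`, `1 < p`, in an inner product space. -/
lemma tendsto_of_midpointDefect_tendsto_zero {ι E : Type*} {l : Filter ι}
    [NormedAddCommGroup E] [InnerProductSpace ℝ E] {p : ℝ} (hp : 1 < p)
    {a : ι → E} {b : E} {c : ℝ} (hc : ∀ᶠ n in l, ‖a n‖ ≤ c)
    (h : Tendsto (fun n => midpointDefect p (a n) b) l (𝓝 0)) :
    Tendsto a l (𝓝 b) := by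
  have hp0 : 0 < p := by linarith
  have hnorm : Tendsto (fun n => ‖a n‖) l (𝓝 ‖b‖) := by
    refine tendsto_of_rpow_defect_tendsto_zero hp (fun n => norm_nonneg _) (norm_nonneg b) hc ?_
    refine squeeze_zero (fun n => ?_) (fun n => ?_) h
    · linarith [rpow_half_add_le hp (norm_nonneg (a n)) (norm_nonneg b)]
    · have := Real.rpow_le_rpow (norm_nonneg _) (norm_half_smul_add_le (a n) b) hp0.le
      unfold midpointDefect
      linarith
  have hcont := Real.continuous_rpow_const hp0.le
  have hpow : Tendsto (fun n => ‖a n‖ ^ p) l (𝓝 (‖b‖ ^ p)) := (hcont.tendsto _).comp hnorm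
  have hmidpow : Tendsto (fun n => ‖(2⁻¹ : ℝ) • (a n + b)‖ ^ p) l (𝓝 (‖b‖ ^ p)) := by
    have := ((hpow.add_const (‖b‖ ^ p)).div_const 2).sub h
    convert this using 2
    · unfold midpointDefect; ring
    · ring
  have hmid : Tendsto (fun n => ‖(2⁻¹ : ℝ) • (a n + b)‖) l (𝓝 ‖b‖) := by
    have := ((Real.continuous_rpow_const (inv_nonneg.2 hp0.le)).tendsto _).comp hmidpow
    simpa only [Function.comp_def, Real.rpow_rpow_inv (norm_nonneg _) hp0.ne'] using this
  have hsq : Tendsto (fun n => ‖a n - b‖ ^ 2) l (𝓝 0) := by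
    have := (((hnorm.pow 2).const_mul 2).add_const (2 * ‖b‖ ^ 2)).sub ((hmid.pow 2).const_mul 4)
    convert this using 2 with n
    · have hpar := parallelogram_law_with_norm ℝ (a n) b
      rw [norm_smul, Real.norm_of_nonneg (by norm_num)]
      linarith
    · ring
  rw [tendsto_iff_norm_sub_tendsto_zero]
  simpa [Real.sqrt_sq (norm_nonneg _)] using hsq.sqrt

lemma tendsto_norm_sq_sub_norm_sq {ι E : Type*} {l : Filter ι} [SeminormedAddCommGroup E]
    {w v : ι → E} {c : ℝ} (hv : ∀ᶠ n in l, ‖v n‖ ≤ c)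
    (h : Tendsto (fun n => w n - v n) l (𝓝 0)) :
    Tendsto (fun n => ‖w n‖ ^ 2 - ‖v n‖ ^ 2) l (𝓝 0) := by
  have hn : Tendsto (fun n => ‖w n - v n‖) l (𝓝 0) := by simpa using h.norm
  have hb : Tendsto (fun n => ‖w n - v n‖ * (‖w n - v n‖ + 2 * c)) l (𝓝 0) := by
    simpa using hn.mul (hn.add_const (2 * c))
  refine squeeze_zero_norm' ?_ hb
  filter_upwards [hv] with n hvn
  have h1 := abs_norm_sub_norm_le (w n) (v n)
  have h2 : ‖w n‖ ≤ ‖w n - v n‖ + ‖v n‖ := by simpa using norm_add_le (w n - v n) (v n)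
  rw [Real.norm_eq_abs, sq_sub_sq, abs_mul, abs_of_nonneg (by positivity : 0 ≤ ‖w n‖ + ‖v n‖),
    mul_comm]
  exact mul_le_mul h1 (by linarith) (by positivity) (norm_nonneg _)

/-- Weak stability for penalization by a linear combination of powers of seminorms
associated to closed operators (Lemma 4.3): minimizers of the perturbed functionals
`Jₙ(x) = ‖Tₙx - yₙ‖² + Σᵢ αᵢⁿ ‖Lᵢx‖^{qᵢ}` converge weakly to the unique minimizer of
`J(x) = ‖Tx - y‖² + Σᵢ αᵢ ‖Lᵢx‖^{qᵢ}`. -/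
theorem weak_stability_sum_closed_operator_penalizers
    {N : ℕ} (hN : 1 ≤ N)
    {X Y : Type*} {Z : Fin N → Type*}
    [NormedAddCommGroup X] [InnerProductSpace ℝ X] [CompleteSpace X]
    [∀ i, NormedAddCommGroup (Z i)] [∀ i, InnerProductSpace ℝ (Z i)]
    [∀ i, CompleteSpace (Z i)]
    [NormedAddCommGroup Y] [InnerProductSpace ℝ Y]
    (T : X →L[ℝ] Y) (Tn : ℕ → X →L[ℝ] Y) (D : Submodule ℝ X)
    (L : ∀ i : Fin N, D →ₗ[ℝ] Z i)
    (hLclosed : ∀ i, IsClosed {p : X × Z i | ∃ x : D, p.1 = (x : X) ∧ p.2 = L i x})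
    (hLrange : ∀ i, IsClosed ((LinearMap.range (L i) : Submodule ℝ (Z i)) : Set (Z i)))
    (k : ℝ) (hk : 0 < k)
    (hcompl : ∀ x : D, k * ‖(x : X)‖ ^ 2 ≤ ‖T (x : X)‖ ^ 2 + ∑ i, ‖L i x‖ ^ 2)
    (q α : Fin N → ℝ) (hq : ∀ i, 1 < q i) (hα : ∀ i, 0 < α i)
    (y : Y) (yn : ℕ → Y) (hyconv : Tendsto yn atTop (𝓝 y))
    (αn : ℕ → Fin N → ℝ) (hαn : ∀ n i, 0 < αn n i)
    (hαconv : ∀ i, Tendsto (fun n => αn n i) atTop (𝓝 (α i)))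
    -- Tₙ x → T x uniformly on subsets of D on which all ‖Lᵢ x‖ are bounded
    (hTconsist : ∀ c : ℝ, 0 < c → ∀ ε : ℝ, 0 < ε → ∃ N₀ : ℕ, ∀ n ≥ N₀, ∀ x : D,
      (∀ i, ‖L i x‖ ≤ c) → ‖Tn n (x : X) - T (x : X)‖ < ε)
    -- x̄ is the unique global minimizer of J on D
    (xbar : D)
    (hxbarmin : ∀ x : D,
      ‖T (xbar : X) - y‖ ^ 2 + ∑ i, α i * ‖L i xbar‖ ^ (q i) ≤
        ‖T (x : X) - y‖ ^ 2 + ∑ i, α i * ‖L i x‖ ^ (q i))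
    (hxbaruniq : ∀ x' : D,
      (∀ x : D,
        ‖T (x' : X) - y‖ ^ 2 + ∑ i, α i * ‖L i x'‖ ^ (q i) ≤
          ‖T (x : X) - y‖ ^ 2 + ∑ i, α i * ‖L i x‖ ^ (q i)) →
      x' = xbar)
    -- each xₙ is a global minimizer of Jₙ on D
    (xn : ℕ → D)
    (hxnmin : ∀ n, ∀ x : D,
      ‖Tn n (xn n : X) - yn n‖ ^ 2 + ∑ i, αn n i * ‖L i (xn n)‖ ^ (q i) ≤
        ‖Tn n (x : X) - yn n‖ ^ 2 + ∑ i, αn n i * ‖L i x‖ ^ (q i)) :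
    ∀ f : X →L[ℝ] ℝ, Tendsto (fun n => f (xn n : X)) atTop (𝓝 (f (xbar : X))) := by
  intro f
  have hTbar : Tendsto (fun n => Tn n (xbar : X)) atTop (𝓝 (T (xbar : X))) := by
    rw [Metric.tendsto_atTop]
    intro ε hε
    obtain ⟨N₀, hN₀⟩ := hTconsist (1 + ∑ i, ‖L i xbar‖) (by positivity) ε hε
    refine ⟨N₀, fun n hn => ?_⟩
    rw [dist_eq_norm]
    refine hN₀ n hn xbar fun i => ?_
    have := Finset.single_le_sum (f := fun i => ‖L i xbar‖) (fun j _ => norm_nonneg _)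
      (Finset.mem_univ i)
    linarith
  have hJbar : Tendsto (fun n => ‖Tn n (xbar : X) - yn n‖ ^ 2 + ∑ i, αn n i * ‖L i xbar‖ ^ q i)
      atTop (𝓝 (‖T (xbar : X) - y‖ ^ 2 + ∑ i, α i * ‖L i xbar‖ ^ q i)) :=
    ((hTbar.sub hyconv).norm.pow 2).add
      (tendsto_finsetSum _ fun i _ => (hαconv i).mul_const _)
  obtain ⟨M, hM⟩ := hJbar.isBoundedUnder_le
  rw [eventually_map] at hM
  have hterm : ∀ n i, 0 ≤ αn n i * ‖L i (xn n)‖ ^ q i := fun n i =>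
    mul_nonneg (hαn n i).le (Real.rpow_nonneg (norm_nonneg _) _)
  have hLpow : ∀ i, ∀ᶠ n in atTop, ‖L i (xn n)‖ ^ q i ≤ 2 * M / α i := fun i => by
    filter_upwards [hM, (hαconv i).eventually_const_le (half_lt_self (hα i))] with n hn hαin
    have h1 := Finset.single_le_sum (f := fun i => αn n i * ‖L i (xn n)‖ ^ q i)
      (fun j _ => hterm n j) (Finset.mem_univ i)
    have h2 := hxnmin n xbar
    have h3 := mul_le_mul_of_nonneg_right hαin (Real.rpow_nonneg (norm_nonneg (L i (xn n))) (q i))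
    rw [le_div_iff₀ (hα i)]
    linarith [sq_nonneg ‖Tn n (xn n : X) - yn n‖]
  have hLb : ∀ i, ∀ᶠ n in atTop, ‖L i (xn n)‖ ≤ 1 + |2 * M / α i| := fun i => by
    filter_upwards [hLpow i] with n hn
    have h0 := le_abs_self (2 * M / α i)
    rcases le_total ‖L i (xn n)‖ 1 with h | h
    · linarith [abs_nonneg (2 * M / α i)]
    · linarith [Real.self_le_rpow_of_one_le h (hq i).le]
  have hTdiff : Tendsto (fun n => Tn n (xn n : X) - T (xn n : X)) atTop (𝓝 0) := by
    rw [Metric.tendsto_atTop']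
    intro ε hε
    obtain ⟨N₀, hN₀⟩ := hTconsist (1 + ∑ i, (1 + |2 * M / α i|)) (by positivity) ε hε
    obtain ⟨N₁, hN₁⟩ := eventually_atTop.1 (eventually_all.2 hLb)
    refine ⟨max N₀ N₁, fun n hn => ?_⟩
    rw [dist_zero_right]
    refine hN₀ n (le_trans (le_max_left _ _) hn.le) (xn n) fun i => ?_
    have h1 := hN₁ n (le_trans (le_max_right _ _) hn.le) i
    have h2 := Finset.single_le_sum (f := fun i => 1 + |2 * M / α i|) (fun j _ => by positivity)
      (Finset.mem_univ i)
    linarith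
  have hresb : ∀ᶠ n in atTop, ‖Tn n (xn n : X) - yn n‖ ≤ 1 + M := by
    filter_upwards [hM] with n hn
    have h1 := Finset.sum_nonneg fun i (_ : i ∈ Finset.univ) => hterm n i
    nlinarith [hxnmin n xbar, sq_nonneg (‖Tn n (xn n : X) - yn n‖ - 1)]
  have hresdiff : Tendsto (fun n => (T (xn n : X) - y) - (Tn n (xn n : X) - yn n)) atTop (𝓝 0) := by
    have := (hyconv.sub_const y).sub hTdiff
    rw [sub_self, sub_zero] at this
    exact this.congr fun n => by abel
  have herr : Tendsto (fun n => (‖T (xn n : X) - y‖ ^ 2 - ‖Tn n (xn n : X) - yn n‖ ^ 2) +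
      ∑ i, (α i - αn n i) * ‖L i (xn n)‖ ^ q i) atTop (𝓝 0) := by
    have hsum : Tendsto (fun n => ∑ i, (α i - αn n i) * ‖L i (xn n)‖ ^ q i) atTop
        (𝓝 (∑ _i : Fin N, (0 : ℝ))) := by
      refine tendsto_finsetSum _ fun i _ => ?_
      have h0 : Tendsto (fun n => α i - αn n i) atTop (𝓝 0) := by
        simpa using (hαconv i).const_sub (α i)
      refine h0.zero_mul_isBoundedUnder_le ⟨2 * M / α i, ?_⟩
      rw [eventually_map]
      filter_upwards [hLpow i] with n hn
      simpa [abs_of_nonneg (Real.rpow_nonneg (norm_nonneg (L i (xn n))) (q i))] using hn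
    simpa using (tendsto_norm_sq_sub_norm_sq hresb hresdiff).add hsum
  have hgap : Tendsto (fun n => (((‖Tn n (xbar : X) - yn n‖ ^ 2 +
      ∑ i, αn n i * ‖L i xbar‖ ^ q i) + ((‖T (xn n : X) - y‖ ^ 2 - ‖Tn n (xn n : X) - yn n‖ ^ 2) +
      ∑ i, (α i - αn n i) * ‖L i (xn n)‖ ^ q i)) -
      (‖T (xbar : X) - y‖ ^ 2 + ∑ i, α i * ‖L i xbar‖ ^ q i)) / 2) atTop (𝓝 0) := by
    have := ((hJbar.add herr).sub_const
      (‖T (xbar : X) - y‖ ^ 2 + ∑ i, α i * ‖L i xbar‖ ^ q i)).div_const 2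
    rwa [add_zero, sub_self, zero_div] at this
  have hdefect : Tendsto (fun n => midpointDefect 2 (T (xn n : X) - y) (T (xbar : X) - y) +
      ∑ i, α i * midpointDefect (q i) (L i (xn n)) (L i xbar)) atTop (𝓝 0) := by
    refine squeeze_zero (fun n => ?_) (fun n => ?_) hgap
    · exact add_nonneg (midpointDefect_nonneg one_lt_two _ _) (Finset.sum_nonneg fun i _ =>
        mul_nonneg (hα i).le (midpointDefect_nonneg (hq i) _ _))
    · have h1 := hxbarmin ((2⁻¹ : ℝ) • (xn n + xbar))
      have h2 := hxnmin n xbar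
      have hmid : T (((2⁻¹ : ℝ) • (xn n + xbar) : D) : X) - y =
          (2⁻¹ : ℝ) • ((T (xn n : X) - y) + (T (xbar : X) - y)) := by
        push_cast
        rw [map_smul, map_add]
        module
      rw [hmid] at h1
      simp only [map_smul, map_add] at h1
      simp only [midpointDefect, Real.rpow_two, mul_sub, sub_mul, Finset.sum_sub_distrib,
        mul_div_assoc', mul_add, ← Finset.sum_div, Finset.sum_add_distrib] at h1 ⊢
      linarith
  have hdT := squeeze_zero (fun n => midpointDefect_nonneg one_lt_two _ _)
    (fun n => le_add_of_nonneg_right (Finset.sum_nonneg fun i _ =>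
      mul_nonneg (hα i).le (midpointDefect_nonneg (hq i) (L i (xn n)) (L i xbar)))) hdefect
  have hdL : ∀ i, Tendsto (fun n => midpointDefect (q i) (L i (xn n)) (L i xbar)) atTop (𝓝 0) := by
    intro i
    have h := squeeze_zero (fun n => mul_nonneg (hα i).le (midpointDefect_nonneg (hq i) _ _))
      (fun n => (Finset.single_le_sum
        (f := fun i => α i * midpointDefect (q i) (L i (xn n)) (L i xbar))
        (fun j _ => mul_nonneg (hα j).le (midpointDefect_nonneg (hq j) _ _))
        (Finset.mem_univ i)).trans
        (le_add_of_nonneg_left (midpointDefect_nonneg one_lt_two _ _))) hdefect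
    simpa [(hα i).ne'] using h.const_mul (α i)⁻¹
  have hwb : ∀ᶠ n in atTop, ‖T (xn n : X) - y‖ ≤ 1 + (1 + M) := by
    have h1 : ∀ᶠ n in atTop, ‖(T (xn n : X) - y) - (Tn n (xn n : X) - yn n)‖ < 1 :=
      hresdiff.norm.eventually_lt_const (by simp)
    filter_upwards [h1, hresb] with n hn hn'
    linarith [norm_sub_norm_le (T (xn n : X) - y) (Tn n (xn n : X) - yn n)]
  have hTconv := tendsto_of_midpointDefect_tendsto_zero one_lt_two hwb hdT
  have hLconv := fun i => tendsto_of_midpointDefect_tendsto_zero (hq i) (hLb i) (hdL i)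
  have hbound : Tendsto (fun n => (‖(T (xn n : X) - y) - (T (xbar : X) - y)‖ ^ 2 +
      ∑ i, ‖L i (xn n) - L i xbar‖ ^ 2) / k) atTop (𝓝 0) := by
    have h1 := (tendsto_iff_norm_sub_tendsto_zero.1 hTconv).pow 2
    have h2 := tendsto_finsetSum Finset.univ fun i (_ : i ∈ Finset.univ) =>
      (tendsto_iff_norm_sub_tendsto_zero.1 (hLconv i)).pow 2
    simpa using (h1.add h2).div_const k
  have hsq : Tendsto (fun n => ‖(xn n : X) - xbar‖ ^ 2) atTop (𝓝 0) := by
    refine squeeze_zero (fun n => sq_nonneg _) (fun n => ?_) hbound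
    rw [le_div_iff₀ hk, mul_comm]
    simpa [sub_sub_sub_cancel_right] using hcompl (xn n - xbar)
  have hstrong : Tendsto (fun n => (xn n : X)) atTop (𝓝 (xbar : X)) := by
    rw [tendsto_iff_norm_sub_tendsto_zero]
    simpa [Real.sqrt_sq (norm_nonneg _)] using hsq.sqrt
  exact (f.continuous.tendsto _).comp hstrong
end
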